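/- arXiv:2306.13463 — 3 statements merged into one kernel-verified Lean document; each statement's English description precedes it below -/
import Mathlib

section
/- Fix an integer g ≥ 1 and μ ∈ ℂ with μ ≠ 0. For a 2g×2g complex matrix S, let π(S) denote the 2g×g matrix formed by the first g columns of S. Then: (1) for every S ∈ M_{2g}(ℂ) with Sᵀ·J·S = μ·J, the matrix N = π(S) satisfies Nᵀ·J·N = 0; and (2) every polynomial over ℂ in the 2g·g entries of a 2g×g matrix that vanishes at π(S) for all S ∈ M_{2g}(ℂ) with Sᵀ·J·S = μ·J also vanishes at every N ∈ M_{2g×g}(ℂ) with Nᵀ·J·N = 0. In other words, the image under π of the set {S : SᵀJS = μJ} is Zariski dense in the set {N ∈ M_{2g×g}(ℂ) : NᵀJN = 0}. -/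
open Matrix MvPolynomial

/-- The standard symplectic matrix `J = [[0, I], [-I, 0]]` of size `2g × 2g`. -/
def Jmat (R : Type*) [CommRing R] (g : ℕ) :
    Matrix (Fin g ⊕ Fin g) (Fin g ⊕ Fin g) R :=
  Matrix.fromBlocks 0 1 (-1) 0

/-- The `2g × g` matrix formed by the first `g` columns of a `2g × 2g` matrix. -/
def firstCols {R : Type*} {g : ℕ}
    (S : Matrix (Fin g ⊕ Fin g) (Fin g ⊕ Fin g) R) :
    Matrix (Fin g ⊕ Fin g) (Fin g) R :=
  S.submatrix id Sum.inl


/-- The `2g × g` matrix with upper block `A` and lower block `0`. -/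
def upMat {g : ℕ} (A : Matrix (Fin g) (Fin g) ℂ) : Matrix (Fin g ⊕ Fin g) (Fin g) ℂ :=
  fromRows A 0

theorem aux_diag {g : ℕ} (Y : Matrix (Fin g) (Fin g) ℂ) :
    ∃ P P' E Q Q' : Matrix (Fin g) (Fin g) ℂ, P * P' = 1 ∧ P' * P = 1 ∧ Q * Q' = 1 ∧ Q' * Q = 1 ∧
      Eᵀ = E ∧ E * E = E ∧ Y = P * E * Q := by
  obtain ⟨L, L', D, h⟩ := Matrix.Pivot.exists_list_transvec_mul_diagonal_mul_list_transvec Y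
  have h1 : IsUnit (L.map TransvectionStruct.toMatrix).prod.det := by simp
  have h2 : IsUnit (L'.map TransvectionStruct.toMatrix).prod.det := by simp
  have h3 : IsUnit (diagonal (fun i => if D i = 0 then (1 : ℂ) else D i)).det := by
    rw [Matrix.det_diagonal, isUnit_iff_ne_zero, Finset.prod_ne_zero_iff]
    intro i _
    split_ifs with h0
    · exact one_ne_zero
    · exact h0
  have h4 : IsUnit (diagonal (fun i => if D i = 0 then (1 : ℂ) else D i) *
      (L'.map TransvectionStruct.toMatrix).prod).det := by
    rw [Matrix.det_mul]
    exact h3.mul h2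
  refine ⟨_, (L.map TransvectionStruct.toMatrix).prod⁻¹,
    diagonal (fun i => if D i = 0 then (0 : ℂ) else 1), _, _, Matrix.mul_nonsing_inv _ h1,
    Matrix.nonsing_inv_mul _ h1, Matrix.mul_nonsing_inv _ h4, Matrix.nonsing_inv_mul _ h4, ?_, ?_, ?_⟩
  · simp
  · simp
  · rw [h]
    simp only [← Matrix.mul_assoc]
    congr 1
    rw [Matrix.mul_assoc, Matrix.diagonal_mul_diagonal]
    congr 2
    funext i
    split_ifs with h0 <;> simp [h0]

theorem aux_mul {g : ℕ} {μ : ℂ} {S T : Matrix (Fin g ⊕ Fin g) (Fin g ⊕ Fin g) ℂ}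
    (hS : Sᵀ * Jmat ℂ g * S = Jmat ℂ g) (hT : Tᵀ * Jmat ℂ g * T = μ • Jmat ℂ g) :
    (S * T)ᵀ * Jmat ℂ g * (S * T) = μ • Jmat ℂ g := by
  rw [Matrix.transpose_mul, ← hT]
  nth_rewrite 2 [← hS]
  simp only [Matrix.mul_assoc]

theorem aux_norm {g : ℕ} (E Z : Matrix (Fin g) (Fin g) ℂ) (hE : Eᵀ = E) (hEE : E * E = E)
    (h : E * Z = Zᵀ * E) :
    ∃ (S : Matrix (Fin g ⊕ Fin g) (Fin g ⊕ Fin g) ℂ) (A : Matrix (Fin g) (Fin g) ℂ),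
      Sᵀ * Jmat ℂ g * S = Jmat ℂ g ∧ fromRows E Z = S * upMat A := by
  have h1 : E * Z * E = E * Z := by rw [h, Matrix.mul_assoc, hEE]
  have h2 : E * Zᵀ * E = E * Z := by rw [Matrix.mul_assoc, ← h, ← Matrix.mul_assoc, hEE]
  have hX : (Z * E + E * Zᵀ - E * Z)ᵀ = Z * E + E * Zᵀ - E * Z := by
    have h5 : (E * Z)ᵀ = E * Z := by
      nth_rewrite 1 [← h1]
      simp only [transpose_mul, hE]
      rw [← Matrix.mul_assoc, h2]
    rw [transpose_sub, h5]
    simp only [transpose_add, transpose_mul, transpose_transpose, hE]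
    abel
  have hXE : (Z * E + E * Zᵀ - E * Z) * E = Z * E := by
    rw [Matrix.sub_mul, Matrix.add_mul, h1, h2, Matrix.mul_assoc, hEE]
    abel
  generalize Z * E + E * Zᵀ - E * Z = X at hX hXE
  have hF1 : E * (1 - E) = 0 := by rw [Matrix.mul_sub, hEE, Matrix.mul_one, sub_self]
  have hF2 : (1 - E) * E = 0 := by rw [Matrix.sub_mul, hEE, Matrix.one_mul, sub_self]
  have hF3 : (1 - E) * (1 - E) = 1 - E := by
    rw [Matrix.mul_sub, hF2, Matrix.mul_one, sub_zero]
  have hA1 : E * (E + Z - Z * E) = E := by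
    rw [Matrix.mul_sub, Matrix.mul_add, hEE, ← Matrix.mul_assoc, h1]
    abel
  have hA2 : (1 - E) * (E + Z - Z * E) = Z - Z * E := by
    rw [Matrix.sub_mul, hA1, Matrix.one_mul]
    abel
  refine ⟨fromBlocks 1 0 X 1 * fromBlocks E (-(1 - E)) (1 - E) E, E + Z - Z * E, ?_, ?_⟩
  · have := aux_mul (μ := 1) (S := fromBlocks 1 0 X 1) (T := fromBlocks E (-(1 - E)) (1 - E) E) ?_ ?_
    · rw [this, one_smul]
    · simp [Jmat, fromBlocks_transpose, fromBlocks_multiply, hX]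
    · rw [one_smul]
      simp only [Jmat, fromBlocks_transpose, fromBlocks_multiply, transpose_neg, transpose_sub,
        transpose_one, hE, Matrix.mul_zero, Matrix.mul_neg, Matrix.mul_one]
      congr 1 <;> simp [Matrix.mul_sub, Matrix.sub_mul, hEE]
      abel
  · rw [upMat, Matrix.mul_assoc, fromBlocks_mul_fromRows, fromBlocks_mul_fromRows, hA1, hA2]
    simp only [Matrix.mul_zero, Matrix.zero_mul, Matrix.one_mul, add_zero, hXE]
    congr 1
    abel

theorem aux_factor {g : ℕ} (N : Matrix (Fin g ⊕ Fin g) (Fin g) ℂ)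
    (hN : Nᵀ * Jmat ℂ g * N = 0) :
    ∃ (S : Matrix (Fin g ⊕ Fin g) (Fin g ⊕ Fin g) ℂ) (A : Matrix (Fin g) (Fin g) ℂ),
      Sᵀ * Jmat ℂ g * S = Jmat ℂ g ∧ N = S * upMat A := by
  obtain ⟨Y, Z, rfl⟩ : ∃ Y Z, N = fromRows Y Z := ⟨N.toRows₁, N.toRows₂, by simp⟩
  have hYZ : Yᵀ * Z = Zᵀ * Y := by
    rw [Jmat, transpose_fromRows, fromCols_mul_fromBlocks, fromCols_mul_fromRows] at hN
    simp at hN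
    rw [← sub_eq_zero, ← hN]; abel
  obtain ⟨P, P', E, Q, Q', hP, hP', hQ, hQ', hE, hEE, rfl⟩ := aux_diag Y
  have ht : Pᵀ * P'ᵀ = 1 := by rw [← transpose_mul, hP', transpose_one]
  have ht' : P'ᵀ * Pᵀ = 1 := by rw [← transpose_mul, hP, transpose_one]
  have hqt : Q'ᵀ * Qᵀ = 1 := by rw [← transpose_mul, hQ, transpose_one]
  have key : E * (Pᵀ * Z * Q') = (Pᵀ * Z * Q')ᵀ * E := by
    have h1 : Q'ᵀ * ((P * E * Q)ᵀ * Z) * Q' = Q'ᵀ * (Zᵀ * (P * E * Q)) * Q' := by rw [hYZ]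
    simp only [transpose_mul, transpose_transpose, hE, Matrix.mul_assoc, hQ, Matrix.mul_one] at h1 ⊢
    rw [← Matrix.mul_assoc Q'ᵀ, hqt, Matrix.one_mul] at h1
    exact h1
  obtain ⟨S, A, hS, hSA⟩ := aux_norm E (Pᵀ * Z * Q') hE hEE key
  refine ⟨fromBlocks P 0 0 P'ᵀ * S, A * Q, ?_, ?_⟩
  · have := aux_mul (μ := 1) (S := fromBlocks P 0 0 P'ᵀ) (T := S) ?_ (by rw [hS, one_smul])
    · rw [this, one_smul]
    · simp [Jmat, fromBlocks_transpose, fromBlocks_multiply, ht, hP']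
  · have : upMat (A * Q) = upMat A * Q := by
      rw [upMat, upMat, fromRows_mul, Matrix.zero_mul]
    have h2 : fromBlocks P 0 0 P'ᵀ * S * (upMat A * Q) =
        fromBlocks P 0 0 P'ᵀ * (S * upMat A * Q) := by
      simp only [Matrix.mul_assoc]
    rw [this, h2, ← hSA, fromRows_mul, fromBlocks_mul_fromRows]
    simp only [Matrix.zero_mul, add_zero, zero_add]
    congr 1
    · simp only [Matrix.mul_assoc]
    · simp only [Matrix.mul_assoc, hQ', Matrix.mul_one]
      rw [← Matrix.mul_assoc, ht', Matrix.one_mul]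

theorem aux_poly {g : ℕ} (μ : ℂ) (S : Matrix (Fin g ⊕ Fin g) (Fin g ⊕ Fin g) ℂ)
    (B : Matrix (Fin g) (Fin g) ℂ) (hS : Sᵀ * Jmat ℂ g * S = Jmat ℂ g) (hB : IsUnit B.det) :
    ∃ T : Matrix (Fin g ⊕ Fin g) (Fin g ⊕ Fin g) ℂ, Tᵀ * Jmat ℂ g * T = μ • Jmat ℂ g ∧
      firstCols T = S * upMat B := by
  refine ⟨S * fromBlocks B 0 0 (μ • B⁻¹ᵀ), aux_mul hS ?_, ?_⟩
  · have h1 : B⁻¹ * B = 1 := Matrix.nonsing_inv_mul _ hB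
    have h2 : Bᵀ * B⁻¹ᵀ = 1 := by rw [← transpose_mul, h1, transpose_one]
    simp [Jmat, fromBlocks_transpose, fromBlocks_multiply, fromBlocks_smul, h1, h2]
  · ext i j
    simp [firstCols, Matrix.mul_apply, upMat]

/-- (1) For every `S` with `Sᵀ·J·S = μ·J`, the `2g × g` matrix `N = π(S)` of its first `g`
columns satisfies `Nᵀ·J·N = 0`; and (2) every polynomial in the entries of a `2g × g` matrix
which vanishes at `π(S)` for all such `S` also vanishes at every `N` with `Nᵀ·J·N = 0`;
i.e., the image under `π` of `{S : SᵀJS = μJ}` is Zariski dense in `{N : NᵀJN = 0}`. -/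
theorem firstCols_of_symplectic_zariski_dense {g : ℕ} (hg : 1 ≤ g) (μ : ℂ) (hμ : μ ≠ 0) :
    (∀ S : Matrix (Fin g ⊕ Fin g) (Fin g ⊕ Fin g) ℂ,
      Sᵀ * Jmat ℂ g * S = μ • Jmat ℂ g →
      (firstCols S)ᵀ * Jmat ℂ g * firstCols S = 0) ∧
    (∀ P : MvPolynomial ((Fin g ⊕ Fin g) × Fin g) ℂ,
      (∀ S : Matrix (Fin g ⊕ Fin g) (Fin g ⊕ Fin g) ℂ,
        Sᵀ * Jmat ℂ g * S = μ • Jmat ℂ g →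
        MvPolynomial.eval (fun p => firstCols S p.1 p.2) P = 0) →
      ∀ N : Matrix (Fin g ⊕ Fin g) (Fin g) ℂ,
        Nᵀ * Jmat ℂ g * N = 0 →
        MvPolynomial.eval (fun p => N p.1 p.2) P = 0) := by
  constructor
  · intro S hS
    have h1 : (firstCols S)ᵀ * Jmat ℂ g * firstCols S =
        (Sᵀ * Jmat ℂ g * S).submatrix Sum.inl Sum.inl := by
      ext i j
      simp [firstCols, Matrix.mul_apply]
    rw [h1, hS]
    ext i j
    simp [Jmat]
  · intro P hP N hN
    obtain ⟨S, A, hS, rfl⟩ := aux_factor N hN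
    let B : Matrix (Fin g ⊕ Fin g) (Fin g) ℂ := S * upMat (1 : Matrix (Fin g) (Fin g) ℂ)
    let q : Polynomial ℂ := MvPolynomial.aeval (fun p : (Fin g ⊕ Fin g) × Fin g =>
      Polynomial.C ((S * upMat A : Matrix (Fin g ⊕ Fin g) (Fin g) ℂ) p.1 p.2) + Polynomial.X * Polynomial.C (B p.1 p.2)) P
    have hq : ∀ t : ℂ, q.eval t =
        MvPolynomial.eval (fun p => (S * upMat (A + t • (1 : Matrix (Fin g) (Fin g) ℂ))) p.1 p.2) P := by
      intro t
      have h1 : S * upMat (A + t • (1 : Matrix (Fin g) (Fin g) ℂ)) = S * upMat A + t • B := by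
        simp only [B]
        rw [← Matrix.mul_smul, ← Matrix.mul_add]
        congr 1
        ext (i | i) j <;> simp [upMat]
      rw [h1]
      have h2 : q.eval t = Polynomial.aeval t q := by simp
      rw [h2]
      simp only [q]
      rw [← AlgHom.comp_apply, MvPolynomial.comp_aeval, MvPolynomial.aeval_eq_eval]
      congr 2
      funext p
      simp
      ring
    have hz : q * (-A).charpoly = 0 := by
      apply Polynomial.funext
      intro t
      rw [Polynomial.eval_mul, Polynomial.eval_zero, Matrix.eval_charpoly]
      by_cases hd : (A + t • (1 : Matrix (Fin g) (Fin g) ℂ)).det = 0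
      · have : (scalar (Fin g)) t - -A = A + t • 1 := by
          rw [sub_neg_eq_add, add_comm, Matrix.scalar_apply, Matrix.smul_one_eq_diagonal]
        rw [this, hd, mul_zero]
      · obtain ⟨T, hT, hT2⟩ := aux_poly μ S _ hS (isUnit_iff_ne_zero.mpr hd)
        have := hP T hT
        rw [hT2] at this
        rw [hq, this, zero_mul]
    have hq0 : q = 0 := (mul_eq_zero.mp hz).resolve_right (Matrix.charpoly_monic _).ne_zero
    have := hq 0
    rw [hq0] at this
    simpa using this.symm
end

section
/- Let K be an algebraically closed field of characteristic zero (for instance, an algebraic closure of ℚ) and let g ≥ 1. Then the ideal I of K[Y,Z] generated by the g² entries of the matrix YᵀZ − ZᵀY is a prime ideal. -/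
open Matrix MvPolynomial

/-- The variable index set for the polynomial ring `K[Y,Z]` in the `2g²` entries of two
`g × g` matrices of indeterminates `Y` (left summand) and `Z` (right summand). -/
abbrev MVar (g : ℕ) := (Fin g × Fin g) ⊕ (Fin g × Fin g)

/-- The `g × g` matrix of indeterminates `Y`. -/
noncomputable def Ymat (K : Type*) [CommRing K] (g : ℕ) :
    Matrix (Fin g) (Fin g) (MvPolynomial (MVar g) K) :=
  Matrix.of fun i j => X (Sum.inl (i, j))

/-- The `g × g` matrix of indeterminates `Z`. -/
noncomputable def Zmat (K : Type*) [CommRing K] (g : ℕ) :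
    Matrix (Fin g) (Fin g) (MvPolynomial (MVar g) K) :=
  Matrix.of fun i j => X (Sum.inr (i, j))

/-- The matrix `Yᵀ·Z − Zᵀ·Y` of trivial relations. -/
noncomputable def relMat (K : Type*) [CommRing K] (g : ℕ) :
    Matrix (Fin g) (Fin g) (MvPolynomial (MVar g) K) :=
  (Ymat K g)ᵀ * Zmat K g - (Zmat K g)ᵀ * Ymat K g

/-- The ideal `I` of `K[Y,Z]` generated by the `g²` entries of `Yᵀ·Z − Zᵀ·Y`. -/
noncomputable def relIdeal (K : Type*) [CommRing K] (g : ℕ) :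
    Ideal (MvPolynomial (MVar g) K) :=
  Ideal.span {p | ∃ i j, p = relMat K g i j}


/-! ### Abstract degeneration lemma -/

section Degen
variable {R : Type*} [CommRing R] (Θ : R →+* Polynomial R)

/-- `M` is the initial ideal of `I` with respect to the grading `Θ`. -/
def IsInit (I M : Ideal R) : Prop :=
  (∀ h ∈ I, ∀ n, (Θ h).natDegree ≤ n → (Θ h).coeff n ∈ M) ∧
  (∀ p ∈ M, ∀ n, ∃ q ∈ I, (Θ q).natDegree ≤ n ∧ (Θ q).coeff n = (Θ p).coeff n)

theorem degen_key {I M : Ideal R} (hG : IsInit Θ I M)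
    (hinj : ∀ h, Θ h = 0 → h = 0)
    (hid : ∀ h n, (Θ ((Θ h).coeff n)).coeff n = (Θ h).coeff n)
    {f m : R} {w : ℕ} (hf : (Θ f).natDegree ≤ w) (hfm : (Θ f).coeff w = m)
    (hm : ∀ c, c * m ∈ M → c ∈ M) (h : R) (n : ℕ) (hn : ∀ k, n ≤ k → (Θ h).coeff k = 0) :
    ∀ (D : ℕ) (c : R), h - c * f ∈ I → (∀ k, D ≤ k → (Θ c).coeff k = 0) →
      ∃ c', c - c' ∈ I ∧ h - c' * f ∈ I ∧ ∀ k, n ≤ k + w → (Θ c').coeff k = 0 := by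
  intro D
  induction D with
  | zero =>
    intro c hc hD
    exact ⟨c, by simp, hc, fun k _ => hD k (Nat.zero_le _)⟩
  | succ D ih =>
    intro c hc hD
    by_cases hlt : D + w < n
    · exact ⟨c, by simp, hc, fun k hk => hD k (by omega)⟩
    have hcD : (Θ c).natDegree ≤ D := by
      rw [Polynomial.natDegree_le_iff_coeff_eq_zero]
      exact fun k hk => hD k hk
    have hcf : (Θ (c * f)).natDegree ≤ D + w := by
      rw [map_mul]; exact Polynomial.natDegree_mul_le_of_le hcD hf
    have hcoef : (Θ (c * f)).coeff (D + w) = (Θ c).coeff D * m := by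
      rw [map_mul, Polynomial.coeff_mul_add_eq_of_natDegree_le hcD hf, hfm]
    have h1 : (Θ (h - c * f)).natDegree ≤ D + w := by
      rw [Polynomial.natDegree_le_iff_coeff_eq_zero] at hcf ⊢
      intro k hk
      rw [map_sub, Polynomial.coeff_sub, hn k (by omega), hcf k hk, sub_zero]
    have h2 := hG.1 _ hc _ h1
    rw [map_sub, Polynomial.coeff_sub, hcoef, hn _ (by omega), zero_sub, neg_mem_iff] at h2
    obtain ⟨q, hqI, hqd, hq⟩ := hG.2 _ (hm _ h2) D
    rw [hid] at hq
    have h3 : h - (c - q) * f ∈ I := by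
      have : h - (c - q) * f = (h - c * f) + f * q := by ring
      rw [this]; exact I.add_mem hc (I.mul_mem_left _ hqI)
    obtain ⟨c', h4, h5, h6⟩ := ih (c - q) h3 (by
      intro k hk
      rw [map_sub, Polynomial.coeff_sub]
      rcases hk.eq_or_lt with rfl | hk
      · rw [hq, sub_self]
      · rw [hD k hk, Polynomial.natDegree_le_iff_coeff_eq_zero.1 hqd k hk, sub_zero])
    refine ⟨c', ?_, h5, h6⟩
    have : c - c' = (c - q - c') + q := by ring
    rw [this]; exact I.add_mem h4 hqI

theorem exists_bound (c : R) : ∀ k, (Θ c).natDegree + 1 ≤ k → (Θ c).coeff k = 0 :=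
  fun _ hk => Polynomial.coeff_eq_zero_of_natDegree_lt hk

theorem degen_nzd {I M : Ideal R} (hG : IsInit Θ I M)
    (hinj : ∀ h, Θ h = 0 → h = 0)
    (hid : ∀ h n, (Θ ((Θ h).coeff n)).coeff n = (Θ h).coeff n)
    {f m : R} {w : ℕ} (hf : (Θ f).natDegree ≤ w) (hfm : (Θ f).coeff w = m)
    (hm : ∀ c, c * m ∈ M → c ∈ M) (c : R) (hc : c * f ∈ I) : c ∈ I := by
  obtain ⟨c', h1, h2, h3⟩ := degen_key Θ hG hinj hid hf hfm hm 0 0 (by simp) _ c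
    (by simpa using hc) (exists_bound Θ c)
  have : c' = 0 := hinj _ (by ext1 k; rw [h3 k (by omega)]; simp)
  simpa [this] using h1

theorem degen_step {I M : Ideal R} (hG : IsInit Θ I M)
    (hinj : ∀ h, Θ h = 0 → h = 0)
    (hid : ∀ h n, (Θ ((Θ h).coeff n)).coeff n = (Θ h).coeff n)
    (hid' : ∀ h n, (Θ ((Θ h).coeff n)).natDegree ≤ n)
    {f m : R} {w : ℕ} (hf : (Θ f).natDegree ≤ w) (hfm : (Θ f).coeff w = m)
    (hΘm : Θ m = Polynomial.C m * Polynomial.X ^ w)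
    (hm : ∀ c, c * m ∈ M → c ∈ M) :
    IsInit Θ (Ideal.span {f} ⊔ I) (Ideal.span {m} ⊔ M) := by
  constructor
  · intro h hh n hn
    obtain ⟨c0, b, hb, hcb⟩ := Ideal.mem_span_singleton_sup.1 hh
    have hc0 : h - c0 * f ∈ I := by rw [← hcb]; simpa using hb
    obtain ⟨c, -, h2, h3⟩ := degen_key Θ hG hinj hid hf hfm hm h (n + 1)
      (fun k hk => Polynomial.natDegree_le_iff_coeff_eq_zero.1 hn k hk) _ c0 hc0
      (exists_bound Θ c0)
    by_cases hw : w ≤ n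
    · obtain ⟨k, rfl⟩ := Nat.exists_eq_add_of_le' hw
      have hcD : (Θ c).natDegree ≤ k := by
        rw [Polynomial.natDegree_le_iff_coeff_eq_zero]
        exact fun l hl => h3 l (by omega)
      have hcf : (Θ (c * f)).natDegree ≤ k + w := by
        rw [map_mul]; exact Polynomial.natDegree_mul_le_of_le hcD hf
      have hcoef : (Θ (c * f)).coeff (k + w) = (Θ c).coeff k * m := by
        rw [map_mul, Polynomial.coeff_mul_add_eq_of_natDegree_le hcD hf, hfm]
      have h4 : (Θ (h - c * f)).natDegree ≤ k + w := by
        rw [map_sub]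
        exact Polynomial.natDegree_sub_le_of_le hn hcf |>.trans (by simp)
      have h5 := hG.1 _ h2 _ h4
      rw [map_sub, Polynomial.coeff_sub, hcoef] at h5
      exact Ideal.mem_span_singleton_sup.2 ⟨(Θ c).coeff k, _, h5, by ring⟩
    · have : c = 0 := hinj _ (by ext1 k; rw [h3 k (by omega)]; simp)
      rw [this, zero_mul, sub_zero] at h2
      exact Ideal.mem_sup_right (hG.1 _ h2 _ hn)
  · intro p hp n
    obtain ⟨c, b, hb, rfl⟩ := Ideal.mem_span_singleton_sup.1 hp
    obtain ⟨q, hq, hqd, hqn⟩ := hG.2 b hb n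
    by_cases hw : w ≤ n
    · obtain ⟨k, rfl⟩ := Nat.exists_eq_add_of_le' hw
      refine ⟨(Θ c).coeff k * f + q, Ideal.mem_span_singleton_sup.2 ⟨_, _, hq, rfl⟩, ?_, ?_⟩
      · rw [map_add, map_mul]
        exact (Polynomial.natDegree_add_le_of_le
          (Polynomial.natDegree_mul_le_of_le (hid' c k) hf) hqd).trans (by simp)
      · rw [map_add, map_mul, Polynomial.coeff_add,
          Polynomial.coeff_mul_add_eq_of_natDegree_le (hid' c k) hf, hfm, hid, hqn, map_add, map_mul,
          hΘm, Polynomial.coeff_add, ← mul_assoc, Polynomial.coeff_mul_X_pow,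
          Polynomial.coeff_mul_C]
    · refine ⟨q, Ideal.mem_sup_right hq, hqd, ?_⟩
      rw [hqn, map_add, map_mul, hΘm, Polynomial.coeff_add, ← mul_assoc,
        Polynomial.coeff_mul_X_pow', if_neg hw, zero_add]

end Degen

/-! ### Weight gradings on polynomial rings -/

section Weight
variable {K : Type*} [Field K] {σ : Type*} (w : σ → ℕ)

/-- The ring map sending `X v` to `X v * t ^ w v`. -/
noncomputable def wtHom : MvPolynomial σ K →+* Polynomial (MvPolynomial σ K) :=
  (aeval (R := K) (fun v => Polynomial.C (X v) * Polynomial.X ^ (w v))).toRingHom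

theorem wtHom_X (v : σ) :
    wtHom (K := K) w (X v) = Polynomial.C (X v) * Polynomial.X ^ (w v) := by
  simp [wtHom]

theorem wtHom_C (a : K) : wtHom (K := K) w (C a) = Polynomial.C (C a) := by
  simp only [wtHom, AlgHom.toRingHom_eq_coe, RingHom.coe_coe, algHom_C]
  rfl

theorem wtHom_eval (h : MvPolynomial σ K) : (wtHom w h).eval 1 = h := by
  induction h using MvPolynomial.induction_on with
  | C a => simp [wtHom_C]
  | add p q hp hq => simp [hp, hq]
  | mul_X p v hp => simp [hp, wtHom_X]

theorem wtHom_inj (h : MvPolynomial σ K) (hh : wtHom w h = 0) : h = 0 := by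
  rw [← wtHom_eval w h, hh]; simp

theorem wtHom_coeff (h : MvPolynomial σ K) (n : ℕ) :
    wtHom w ((wtHom w h).coeff n) = Polynomial.C ((wtHom w h).coeff n) * Polynomial.X ^ n := by
  induction h using MvPolynomial.induction_on generalizing n with
  | C a =>
    rw [wtHom_C, Polynomial.coeff_C]
    split_ifs with h
    · simp [wtHom_C, h]
    · simp
  | add p q hp hq => simp [hp, hq, add_mul]
  | mul_X p v hp =>
    rw [map_mul, wtHom_X, ← mul_assoc, Polynomial.coeff_mul_X_pow']
    split_ifs with h
    · rw [Polynomial.coeff_mul_C, map_mul, hp, wtHom_X, map_mul]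
      obtain ⟨k, rfl⟩ := Nat.exists_eq_add_of_le' h
      simp only [Nat.add_sub_cancel]
      ring
    · simp

theorem wtHom_coeff_coeff (h : MvPolynomial σ K) (n : ℕ) :
    (wtHom w ((wtHom w h).coeff n)).coeff n = (wtHom w h).coeff n := by
  rw [wtHom_coeff]; simp

theorem wtHom_coeff_natDegree (h : MvPolynomial σ K) (n : ℕ) :
    (wtHom w ((wtHom w h).coeff n)).natDegree ≤ n := by
  rw [wtHom_coeff]; exact Polynomial.natDegree_C_mul_X_pow_le _ _

/-- A monomial coprime to a set of monomials is regular modulo the ideal they generate. -/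
theorem monomial_nzd (S : Set (σ →₀ ℕ)) (e : σ →₀ ℕ)
    (he : ∀ s ∈ S, ∀ v, s v = 0 ∨ e v = 0) (c : MvPolynomial σ K)
    (hc : c * monomial e 1 ∈ Ideal.span ((fun s => monomial s (1 : K)) '' S)) :
    c ∈ Ideal.span ((fun s => monomial s (1 : K)) '' S) := by
  rw [mem_ideal_span_monomial_image] at hc ⊢
  intro d hd
  obtain ⟨s, hs, hsd⟩ := hc (d + e) (by
    rw [mem_support_iff, coeff_mul_monomial]
    simpa using hd)
  refine ⟨s, hs, fun v => ?_⟩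
  have := hsd v
  rw [Finsupp.add_apply] at this
  rcases he s hs v with h | h <;> omega

theorem isInit_finset {ι : Type*} [DecidableEq ι] (f : ι → MvPolynomial σ K) (e : ι → σ →₀ ℕ)
    (W : ι → ℕ) (T : Finset ι)
    (hf : ∀ a ∈ T, (wtHom w (f a)).natDegree ≤ W a)
    (hfm : ∀ a ∈ T, (wtHom w (f a)).coeff (W a) = monomial (e a) 1)
    (he : ∀ a ∈ T, ∀ b ∈ T, a ≠ b → ∀ v, e a v = 0 ∨ e b v = 0) :
    IsInit (wtHom w) (Ideal.span (f '' T))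
      (Ideal.span ((fun s => monomial s (1 : K)) '' (e '' T))) := by
  induction T using Finset.induction_on with
  | empty =>
    constructor
    · intro h hh n _
      have : h = 0 := by simpa using hh
      simp [this]
    · intro p hp n
      have : p = 0 := by simpa using hp
      exact ⟨0, by simp, by simp, by simp [this]⟩
  | insert b T hb ih =>
    have ih := ih (fun a ha => hf a (by simp [ha])) (fun a ha => hfm a (by simp [ha]))
      (fun a ha c hc => he a (by simp [ha]) c (by simp [hc]))
    have key := degen_step (wtHom w) ih (wtHom_inj w) (wtHom_coeff_coeff w)
      (wtHom_coeff_natDegree w) (hf b (by simp)) (hfm b (by simp))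
      (by rw [← hfm b (by simp), wtHom_coeff])
      (fun c hc => monomial_nzd _ (e b) (by
        rintro _ ⟨a, ha, rfl⟩ v
        exact he a (by simp at ha; simp [ha]) b (by simp) (by rintro rfl; exact hb ha) v) c hc)
    rw [Finset.coe_insert, Set.image_insert_eq, Set.image_insert_eq, Set.image_insert_eq,
      Ideal.span_insert, Ideal.span_insert]
    exact key

end Weight

/-! ### The weights -/

section Rel
variable {K : Type*} [Field K] {g : ℕ}

/-- The weights of the variables. -/
def relWt (g : ℕ) : MVar g → ℕ
  | Sum.inl (k, i) => 2 * k * i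
  | Sum.inr (k, j) => (4 * g * g - 2 * k) * j + (2 * g - k) * k

/-- Exponent of the initial monomial of `relMat i j`. -/
noncomputable def relExp [NeZero g] (p : Fin g × Fin g) : MVar g →₀ ℕ :=
  Finsupp.single (Sum.inl (p.1 - p.2, p.1)) 1 + Finsupp.single (Sum.inr (p.1 - p.2, p.2)) 1

/-- Weight of the initial monomial. -/
def relW [NeZero g] (p : Fin g × Fin g) : ℕ :=
  relWt g (Sum.inl (p.1 - p.2, p.1)) + relWt g (Sum.inr (p.1 - p.2, p.2))

theorem wt_lt1 [NeZero g] {i j : Fin g} (hij : i < j) (k : Fin g) (hk : k ≠ i - j) :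
    relWt g (Sum.inl (k, i)) + relWt g (Sum.inr (k, j)) < relW (i, j) := by
  have h0 : ((i - j : Fin g) : ℕ) = g + i - j := Fin.coe_sub_iff_lt.2 hij
  have hne : (k : ℕ) ≠ g + i - j := fun h => hk (Fin.ext (h.trans h0.symm))
  simp only [relW, relWt, h0]
  have hk' := k.2
  have hi' := i.2
  have hj' := j.2
  have hij' : (i : ℕ) < j := hij
  generalize (k : ℕ) = k at *
  generalize (i : ℕ) = i at *
  generalize (j : ℕ) = j at *
  obtain ⟨d, hd⟩ : ∃ d, d = g + i - j := ⟨_, rfl⟩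
  rw [← hd] at hne ⊢
  have e1 : 2 * k ≤ 4 * g * g := by nlinarith
  have e2 : 2 * d ≤ 4 * g * g := by nlinarith [show d < g by omega]
  have e3 : k ≤ 2 * g := by omega
  have e4 : d ≤ 2 * g := by omega
  have e5 : (d : ℤ) = g + i - j := by omega
  zify [e1, e2, e3, e4]
  have : 0 < ((k : ℤ) - d) ^ 2 := by
    have : (k : ℤ) - d ≠ 0 := by omega
    positivity
  have e6 : (j : ℤ) = g + i - d := by linarith
  rw [e6]
  nlinarith

theorem wt_lt2 [NeZero g] {i j : Fin g} (hij : i < j) (k : Fin g) :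
    relWt g (Sum.inr (k, i)) + relWt g (Sum.inl (k, j)) < relW (i, j) := by
  have h0 : ((i - j : Fin g) : ℕ) = g + i - j := Fin.coe_sub_iff_lt.2 hij
  simp only [relW, relWt, h0]
  have hk' := k.2
  have hi' := i.2
  have hj' := j.2
  have hij' : (i : ℕ) < j := hij
  generalize (k : ℕ) = k at *
  generalize (i : ℕ) = i at *
  generalize (j : ℕ) = j at *
  obtain ⟨d, hd⟩ : ∃ d, d = g + i - j := ⟨_, rfl⟩
  rw [← hd]
  have e1 : 2 * k ≤ 4 * g * g := by nlinarith
  have e2 : 2 * d ≤ 4 * g * g := by nlinarith [show d < g by omega]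
  have e3 : k ≤ 2 * g := by omega
  have e4 : d ≤ 2 * g := by omega
  have e5 : (d : ℤ) = g + i - j := by omega
  zify [e1, e2, e3, e4]
  have e6 : (j : ℤ) = g + i - d := by linarith
  obtain ⟨s, hs⟩ : ∃ s, j = i + 1 + s := ⟨j - i - 1, by omega⟩
  have e7 : (d : ℤ) = g - 1 - s := by rw [e5, hs]; push_cast; ring
  rw [e7, hs]
  push_cast
  have a1 : (k : ℤ) + 1 ≤ g := by omega
  have a2 : (s : ℤ) + 2 ≤ g := by omega
  have a0 : (0 : ℤ) ≤ k := by positivity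
  have a3 : (0 : ℤ) ≤ s := by positivity
  have a4 : 0 ≤ (g - 1 - (s : ℤ)) ^ 2 := by positivity
  have a5 : (k : ℤ) * (1 + s) ≤ (g - 1) * (g - 1) := by
    apply mul_le_mul <;> linarith
  have a6 : (k : ℤ) * g ≤ (g - 1) * g := by
    apply mul_le_mul <;> linarith
  nlinarith [mul_nonneg (mul_nonneg a3 (by linarith : (0:ℤ) ≤ g)) (by linarith : (0:ℤ) ≤ g),
    sq_nonneg (k : ℤ)]

theorem wtHom_rel [NeZero g] (i j : Fin g) :
    wtHom (relWt g) (relMat K g i j) = ∑ k,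
      (Polynomial.C (X (Sum.inl (k, i)) * X (Sum.inr (k, j))) *
        Polynomial.X ^ (relWt g (Sum.inl (k, i)) + relWt g (Sum.inr (k, j)))
      - Polynomial.C (X (Sum.inr (k, i)) * X (Sum.inl (k, j))) *
        Polynomial.X ^ (relWt g (Sum.inr (k, i)) + relWt g (Sum.inl (k, j)))) := by
  simp only [relMat, Matrix.sub_apply, Matrix.mul_apply, ← Finset.sum_sub_distrib, map_sum,
    map_sub, map_mul, Matrix.transpose_apply, Ymat, Zmat, Matrix.of_apply, wtHom_X]
  refine Finset.sum_congr rfl fun k _ => ?_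
  ring

theorem rel_natDegree [NeZero g] {i j : Fin g} (hij : i < j) :
    (wtHom (relWt g) (relMat K g i j)).natDegree ≤ relW (i, j) := by
  rw [wtHom_rel]
  refine Polynomial.natDegree_sum_le_of_forall_le _ _ fun k _ => ?_
  refine (Polynomial.natDegree_sub_le_of_le (Polynomial.natDegree_C_mul_X_pow_le _ _)
    (Polynomial.natDegree_C_mul_X_pow_le _ _)).trans (max_le ?_ (wt_lt2 hij k).le)
  by_cases hk : k = i - j
  · rw [hk]; rfl
  · exact (wt_lt1 hij k hk).le

theorem rel_coeff [NeZero g] {i j : Fin g} (hij : i < j) :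
    (wtHom (relWt g) (relMat K g i j)).coeff (relW (i, j)) = monomial (relExp (i, j)) 1 := by
  rw [wtHom_rel, Polynomial.finsetSum_coeff, Finset.sum_eq_single (i - j)]
  · rw [Polynomial.coeff_sub, Polynomial.coeff_C_mul_X_pow, Polynomial.coeff_C_mul_X_pow,
      if_pos (by rfl), if_neg (wt_lt2 hij _).ne', sub_zero]
    simp [relExp, X, monomial_mul]
  · intro k _ hk
    rw [Polynomial.coeff_sub, Polynomial.coeff_C_mul_X_pow, Polynomial.coeff_C_mul_X_pow,
      if_neg (wt_lt1 hij k hk).ne', if_neg (wt_lt2 hij _).ne', sub_zero]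
  · simp

theorem relExp_disj [NeZero g] (p q : Fin g × Fin g) (hpq : p ≠ q) (v : MVar g) :
    relExp p v = 0 ∨ relExp q v = 0 := by
  obtain ⟨i, j⟩ := p
  obtain ⟨i', j'⟩ := q
  by_contra! hcon
  obtain ⟨h1, h2⟩ := hcon
  apply hpq
  rcases v with ⟨a, b⟩ | ⟨a, b⟩
  · simp only [relExp, Finsupp.add_apply, Finsupp.single_apply, Sum.inl.injEq, Prod.mk.injEq,
      reduceCtorEq, if_false, add_zero, ne_eq, ite_eq_right_iff, one_ne_zero, imp_false,
      not_not] at h1 h2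
    obtain ⟨h1, rfl⟩ := h1
    obtain ⟨h2, rfl⟩ := h2
    rw [← h2] at h1
    rw [sub_right_injective h1]
  · simp only [relExp, Finsupp.add_apply, Finsupp.single_apply, Sum.inr.injEq, Prod.mk.injEq,
      reduceCtorEq, if_false, zero_add, ne_eq, ite_eq_right_iff, one_ne_zero, imp_false,
      not_not] at h1 h2
    obtain ⟨h1, rfl⟩ := h1
    obtain ⟨h2, rfl⟩ := h2
    rw [← h2] at h1
    rw [sub_left_injective h1]

/-- Exponent of the initial monomial of `det Y`. -/
noncomputable def detExp (g : ℕ) : MVar g →₀ ℕ := ∑ i : Fin g, Finsupp.single (Sum.inl (i, i)) 1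

theorem detExp_disj [NeZero g] {i j : Fin g} (hij : i < j) (v : MVar g) :
    relExp (i, j) v = 0 ∨ detExp g v = 0 := by
  by_contra! hcon
  obtain ⟨h1, h2⟩ := hcon
  rw [detExp, Finsupp.finsetSum_apply] at h2
  obtain ⟨k, -, hk⟩ := Finset.exists_ne_zero_of_sum_ne_zero h2
  have hv : Sum.inl (k, k) = v := by
    by_contra h
    exact hk (by simp [Finsupp.single_apply, h])
  subst hv
  simp only [relExp, Finsupp.add_apply, Finsupp.single_apply, Sum.inl.injEq, Prod.mk.injEq,
      reduceCtorEq, if_false, add_zero, ne_eq, ite_eq_right_iff, one_ne_zero, imp_false,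
      not_not] at h1
  obtain ⟨h1, rfl⟩ := h1
  have : j = 0 := by simpa using h1
  subst this
  exact absurd hij (Fin.not_lt_zero _)

theorem wtHom_det : wtHom (relWt g) (Ymat K g).det = ∑ s : Equiv.Perm (Fin g),
    Polynomial.C (((Equiv.Perm.sign s : ℤ) : MvPolynomial (MVar g) K) *
      ∏ i, X (Sum.inl (s i, i))) * Polynomial.X ^ (∑ i, 2 * (s i : ℕ) * i) := by
  rw [Matrix.det_apply', map_sum]
  refine Finset.sum_congr rfl fun s _ => ?_
  simp only [map_mul, map_prod, map_intCast, Ymat, Matrix.of_apply, wtHom_X, relWt,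
    Finset.prod_mul_distrib, Finset.prod_pow_eq_pow_sum]
  ring

theorem perm_lt (s : Equiv.Perm (Fin g)) (hs : s ≠ 1) :
    ∑ i, 2 * (s i : ℕ) * i < ∑ i : Fin g, 2 * (i : ℕ) * i := by
  zify
  have h1 : ∑ i, ((s i : ℕ) : ℤ) ^ 2 = ∑ i : Fin g, ((i : ℕ) : ℤ) ^ 2 :=
    Equiv.sum_comp s (fun i => ((i : ℕ) : ℤ) ^ 2)
  have h2 : 0 < ∑ i, (((s i : ℕ) : ℤ) - (i : ℕ)) ^ 2 := by
    obtain ⟨i, hi⟩ : ∃ i, s i ≠ i := by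
      by_contra! h
      exact hs (Equiv.ext h)
    refine Finset.sum_pos' (fun _ _ => sq_nonneg _) ⟨i, Finset.mem_univ _, ?_⟩
    have : ((s i : ℕ) : ℤ) - (i : ℕ) ≠ 0 := by
      intro h
      exact hi (Fin.ext (by omega))
    positivity
  have h3 : ∑ i, (((s i : ℕ) : ℤ) - (i : ℕ)) ^ 2 = ∑ i, ((s i : ℕ) : ℤ) ^ 2
      + ∑ i : Fin g, ((i : ℕ) : ℤ) ^ 2 - ∑ i, 2 * ((s i : ℕ) : ℤ) * (i : ℕ) := by
    rw [← Finset.sum_add_distrib, ← Finset.sum_sub_distrib]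
    exact Finset.sum_congr rfl fun i _ => by ring
  have h4 : ∑ i : Fin g, 2 * ((i : ℕ) : ℤ) * (i : ℕ) = 2 * ∑ i : Fin g, ((i : ℕ) : ℤ) ^ 2 := by
    rw [Finset.mul_sum]
    exact Finset.sum_congr rfl fun i _ => by ring
  rw [h4]
  linarith

theorem det_natDegree :
    (wtHom (relWt g) (Ymat K g).det).natDegree ≤ ∑ i : Fin g, 2 * (i : ℕ) * i := by
  rw [wtHom_det]
  refine Polynomial.natDegree_sum_le_of_forall_le _ _ fun s _ => ?_
  refine (Polynomial.natDegree_C_mul_X_pow_le _ _).trans ?_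
  by_cases hs : s = 1
  · rw [hs]; rfl
  · exact (perm_lt s hs).le

theorem det_coeff :
    (wtHom (relWt g) (Ymat K g).det).coeff (∑ i : Fin g, 2 * (i : ℕ) * i)
      = monomial (detExp g) 1 := by
  rw [wtHom_det, Polynomial.finsetSum_coeff, Finset.sum_eq_single 1]
  · rw [Polynomial.coeff_C_mul_X_pow, if_pos (by simp), detExp, monomial_sum_one]
    simp [X]
  · intro s _ hs
    rw [Polynomial.coeff_C_mul_X_pow, if_neg (perm_lt s hs).ne']
  · simp

/-- The index set of independent relations. -/
def relIdx (g : ℕ) : Finset (Fin g × Fin g) := Finset.univ.filter fun p => p.1 < p.2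

theorem relMat_swap (i j : Fin g) : relMat K g j i = - relMat K g i j := by
  simp only [relMat, Matrix.sub_apply, Matrix.mul_apply, Matrix.transpose_apply, neg_sub]
  congr 1 <;> exact Finset.sum_congr rfl fun k _ => mul_comm _ _

theorem relMat_diag (i : Fin g) : relMat K g i i = 0 := by
  simp only [relMat, Matrix.sub_apply, Matrix.mul_apply, Matrix.transpose_apply, sub_eq_zero]
  exact Finset.sum_congr rfl fun k _ => mul_comm _ _

theorem relIdeal_eq : relIdeal K g =
    Ideal.span ((fun p : Fin g × Fin g => relMat K g p.1 p.2) '' (relIdx g)) := by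
  apply le_antisymm
  · rw [relIdeal, Ideal.span_le]
    rintro _ ⟨i, j, rfl⟩
    rcases lt_trichotomy i j with h | rfl | h
    · exact Ideal.subset_span ⟨(i, j), by simp [relIdx, h], rfl⟩
    · rw [relMat_diag]; exact Ideal.zero_mem _
    · rw [relMat_swap]
      exact neg_mem (Ideal.subset_span ⟨(j, i), by simp [relIdx, h], rfl⟩)
  · rw [relIdeal, Ideal.span_le]
    rintro _ ⟨p, -, rfl⟩
    exact Ideal.subset_span ⟨p.1, p.2, rfl⟩

theorem det_nzd [NeZero g] (c : MvPolynomial (MVar g) K) (hc : c * (Ymat K g).det ∈ relIdeal K g) :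
    c ∈ relIdeal K g := by
  rw [relIdeal_eq] at hc ⊢
  have hlt : ∀ a ∈ relIdx g, a.1 < a.2 := fun a ha => by simpa [relIdx] using ha
  have hG := isInit_finset (K := K) (relWt g) (fun p : Fin g × Fin g => relMat K g p.1 p.2)
    relExp relW (relIdx g) (fun a ha => rel_natDegree (hlt a ha))
    (fun a ha => rel_coeff (hlt a ha)) (fun a _ b _ hab v => relExp_disj a b hab v)
  refine degen_nzd (wtHom (relWt g)) hG (wtHom_inj _) (wtHom_coeff_coeff _) det_natDegree
    det_coeff (fun c hc => monomial_nzd _ _ ?_ c hc) c hc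
  rintro _ ⟨a, ha, rfl⟩ v
  exact detExp_disj (hlt a ha) v

theorem det_pow_nzd [NeZero g] (n : ℕ) (c : MvPolynomial (MVar g) K)
    (hc : (Ymat K g).det ^ n * c ∈ relIdeal K g) : c ∈ relIdeal K g := by
  induction n with
  | zero => simpa using hc
  | succ n ih =>
    apply ih
    apply det_nzd
    convert hc using 1
    ring

/-! ### Parametrisation of the open set `det Y ≠ 0` -/

variable (K g)

/-- Coordinate ring of pairs (matrix, symmetric matrix). -/
abbrev ParRing := MvPolynomial ((Fin g × Fin g) ⊕ Sym2 (Fin g)) K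

/-- Generic matrix over the fraction field. -/
noncomputable def parY : Matrix (Fin g) (Fin g) (ParRing K g) :=
  Matrix.of fun i j => X (Sum.inl (i, j))

/-- Generic symmetric matrix. -/
noncomputable def parS : Matrix (Fin g) (Fin g) (ParRing K g) :=
  Matrix.of fun i j => X (Sum.inr s(i, j))

/-- Embedding of matrices into the fraction field. -/
noncomputable def parYF : Matrix (Fin g) (Fin g) (FractionRing (ParRing K g)) :=
  (parY K g).map (algebraMap _ _)

/-- Embedding of matrices into the fraction field. -/
noncomputable def parSF : Matrix (Fin g) (Fin g) (FractionRing (ParRing K g)) :=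
  (parS K g).map (algebraMap _ _)

/-- The parametrisation. -/
noncomputable def parHom : MvPolynomial (MVar g) K →ₐ[K] FractionRing (ParRing K g) :=
  aeval fun v => match v with
    | Sum.inl (i, j) => parYF K g i j
    | Sum.inr (i, j) => (((parYF K g)ᵀ)⁻¹ * parSF K g) i j

/-- The map back. -/
noncomputable def backHom : ParRing K g →ₐ[K] MvPolynomial (MVar g) K :=
  aeval fun v => match v with
    | Sum.inl (i, j) => X (Sum.inl (i, j))
    | Sum.inr s => ((Ymat K g)ᵀ * Zmat K g) s.out.1 s.out.2

theorem parHom_Y : (Ymat K g).map (parHom K g) = parYF K g := by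
  ext i j; simp [Ymat, parHom]

theorem parHom_Z : (Zmat K g).map (parHom K g) = ((parYF K g)ᵀ)⁻¹ * parSF K g := by
  ext i j; simp [Zmat, parHom]

theorem parY_det : (parY K g).det ≠ 0 := by
  intro h
  have := congrArg (aeval (R := K) (S₁ := K) (fun v : (Fin g × Fin g) ⊕ Sym2 (Fin g) => match v with
    | Sum.inl (i, j) => (1 : Matrix (Fin g) (Fin g) K) i j
    | Sum.inr _ => 0)) h
  rw [AlgHom.map_det, map_zero] at this
  have h2 : (AlgHom.mapMatrix (aeval (R := K) (S₁ := K)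
    (fun v : (Fin g × Fin g) ⊕ Sym2 (Fin g) => match v with
    | Sum.inl (i, j) => (1 : Matrix (Fin g) (Fin g) K) i j
    | Sum.inr _ => 0))) (parY K g) = 1 := by
    ext i j; simp [parY]
  rw [h2] at this
  simp at this

theorem parYF_det : IsUnit ((parYF K g)ᵀ).det := by
  rw [Matrix.det_transpose, isUnit_iff_ne_zero, parYF]
  have : ((parY K g).map (algebraMap (ParRing K g) (FractionRing (ParRing K g)))).det
    = algebraMap (ParRing K g) (FractionRing (ParRing K g)) (parY K g).det := by
    rw [RingHom.map_det]; rfl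
  rw [this]
  intro h
  exact parY_det K g ((IsFractionRing.injective (ParRing K g) (FractionRing (ParRing K g)))
    (by rw [h, map_zero]))

theorem parHom_YZ : ((Ymat K g)ᵀ * Zmat K g).map (parHom K g) = parSF K g := by
  rw [Matrix.map_mul, Matrix.transpose_map, parHom_Y, parHom_Z, ← mul_assoc,
    Matrix.mul_nonsing_inv _ (parYF_det K g), one_mul]

theorem parSF_symm : (parSF K g)ᵀ = parSF K g := by
  ext i j; simp [parSF, parS, Sym2.eq_swap]

theorem parHom_ZY : ((Zmat K g)ᵀ * Ymat K g).map (parHom K g) = parSF K g := by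
  rw [← parSF_symm, ← parHom_YZ, ← Matrix.transpose_map, Matrix.transpose_mul,
    Matrix.transpose_transpose]

theorem parHom_rel (h : MvPolynomial (MVar g) K) (hh : h ∈ relIdeal K g) : parHom K g h = 0 := by
  suffices relIdeal K g ≤ RingHom.ker (parHom K g) from this hh
  rw [relIdeal, Ideal.span_le]
  rintro _ ⟨i, j, rfl⟩
  have h1 := congrFun (congrFun (parHom_YZ K g) i) j
  have h2 := congrFun (congrFun (parHom_ZY K g) i) j
  rw [Matrix.map_apply] at h1 h2
  simp only [SetLike.mem_coe, RingHom.mem_ker, relMat, Matrix.sub_apply, map_sub, h1, h2, sub_self]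

theorem out_mk {α : Type*} (i j : α) :
    (s(i, j).out = (i, j)) ∨ (s(i, j).out = (j, i)) := by
  have h : s((s(i, j).out).1, (s(i, j).out).2) = s(i, j) := Quot.out_eq s(i, j)
  rcases Sym2.eq_iff.1 h with ⟨h1, h2⟩ | ⟨h1, h2⟩
  · exact Or.inl (Prod.ext h1 h2)
  · exact Or.inr (Prod.ext h1 h2)

theorem parHom_back (p : ParRing K g) :
    parHom K g (backHom K g p) = algebraMap _ (FractionRing (ParRing K g)) p := by
  have : (parHom K g).comp (backHom K g) =
      IsScalarTower.toAlgHom K (ParRing K g) (FractionRing (ParRing K g)) := by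
    apply MvPolynomial.algHom_ext
    rintro (⟨i, j⟩ | s)
    · simp [backHom, parHom, parYF, parY]
    · have h1 := congrFun (congrFun (parHom_YZ K g) s.out.1) s.out.2
      rw [Matrix.map_apply] at h1
      have h2 : s(s.out.1, s.out.2) = s := Quot.out_eq s
      simp only [AlgHom.comp_apply, backHom, aeval_X, h1]
      simp [parSF, parS, h2]
  exact DFunLike.congr_fun this p

theorem back_S (i j : Fin g) :
    ((Ymat K g)ᵀ * Zmat K g) i j - backHom K g (parS K g i j) ∈ relIdeal K g := by
  have h : backHom K g (parS K g i j) = ((Ymat K g)ᵀ * Zmat K g) s(i, j).out.1 s(i, j).out.2 := by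
    simp [backHom, parS]
  rw [h]
  rcases out_mk i j with h | h
  · rw [h]; simp
  · rw [h]
    refine Ideal.subset_span ⟨i, j, ?_⟩
    rw [relMat, Matrix.sub_apply]
    congr 1
    simp only [Matrix.mul_apply, Matrix.transpose_apply]
    exact Finset.sum_congr rfl fun k _ => mul_comm _ _

theorem back_Y : (parY K g).map (backHom K g) = Ymat K g := by
  ext i j; simp [parY, backHom, Ymat]

theorem back_det : backHom K g (parY K g).det = (Ymat K g).det := by
  rw [AlgHom.map_det, AlgHom.mapMatrix_apply, back_Y]

theorem exists_back (h : MvPolynomial (MVar g) K) :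
    ∃ (n : ℕ) (p : ParRing K g), (Ymat K g).det ^ n * h - backHom K g p ∈ relIdeal K g := by
  induction h using MvPolynomial.induction_on with
  | C a => exact ⟨0, C a, by simp [backHom]⟩
  | add a b ha hb =>
    obtain ⟨n, p, hp⟩ := ha
    obtain ⟨m, q, hq⟩ := hb
    refine ⟨n + m, (parY K g).det ^ m * p + (parY K g).det ^ n * q, ?_⟩
    rw [map_add, map_mul, map_mul, map_pow, map_pow, back_det]
    have := Ideal.add_mem _ (Ideal.mul_mem_left _ ((Ymat K g).det ^ m) hp)
      (Ideal.mul_mem_left _ ((Ymat K g).det ^ n) hq)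
    convert this using 1
    ring
  | mul_X a v ha =>
    obtain ⟨n, p, hp⟩ := ha
    obtain ⟨m, q, hq⟩ : ∃ (m : ℕ) (q : ParRing K g),
        (Ymat K g).det ^ m * X v - backHom K g q ∈ relIdeal K g := by
      rcases v with ⟨i, j⟩ | ⟨i, j⟩
      · exact ⟨0, X (Sum.inl (i, j)), by simp [backHom]⟩
      · refine ⟨1, (((parY K g)ᵀ).adjugate * parS K g) i j, ?_⟩
        have h1 : (Ymat K g).det ^ 1 * X (Sum.inr (i, j)) =
            (((Ymat K g)ᵀ).adjugate * ((Ymat K g)ᵀ * Zmat K g)) i j := by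
          rw [← mul_assoc, Matrix.adjugate_mul, Matrix.det_transpose]
          simp [Zmat]
        have h2 : backHom K g ((((parY K g)ᵀ).adjugate * parS K g) i j) =
            ∑ k, ((Ymat K g)ᵀ).adjugate i k * backHom K g (parS K g k j) := by
          rw [Matrix.mul_apply, map_sum]
          refine Finset.sum_congr rfl fun k _ => ?_
          rw [map_mul]
          congr 1
          have := AlgHom.map_adjugate (backHom K g) (parY K g)ᵀ
          have := congrFun (congrFun this i) k
          rw [AlgHom.mapMatrix_apply, AlgHom.mapMatrix_apply, Matrix.transpose_map, back_Y] at this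
          exact this
        rw [h1, h2, Matrix.mul_apply, ← Finset.sum_sub_distrib]
        refine Ideal.sum_mem _ fun k _ => ?_
        rw [← mul_sub]
        exact Ideal.mul_mem_left _ _ (back_S K g k j)
    refine ⟨n + m, p * q, ?_⟩
    rw [map_mul]
    have := Ideal.add_mem _ (Ideal.mul_mem_left _ ((Ymat K g).det ^ m * X v) hp)
      (Ideal.mul_mem_left _ (backHom K g p) hq)
    convert this using 1
    ring

theorem relIdeal_ker [NeZero g] : relIdeal K g = RingHom.ker (parHom K g) := by
  apply le_antisymm
  · exact fun h hh => parHom_rel K g h hh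
  · intro h hh
    rw [RingHom.mem_ker] at hh
    obtain ⟨n, p, hp⟩ := exists_back K g h
    have h1 := parHom_rel K g _ hp
    rw [map_sub, map_mul, hh, mul_zero, zero_sub, neg_eq_zero, parHom_back] at h1
    have h2 : p = 0 := IsFractionRing.injective (ParRing K g) (FractionRing (ParRing K g))
      (by rw [h1, map_zero])
    rw [h2, map_zero, sub_zero] at hp
    exact det_pow_nzd n h hp

end Rel

/-- Over an algebraically closed field of characteristic zero, the ideal `I` generated by the
entries of `Yᵀ·Z − Zᵀ·Y` is prime. -/
theorem relIdeal_isPrime {K : Type*} [Field K] [IsAlgClosed K] [CharZero K]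
    {g : ℕ} (hg : 1 ≤ g) :
    (relIdeal K g).IsPrime := by
  haveI : NeZero g := ⟨by omega⟩
  rw [relIdeal_ker]
  exact RingHom.ker_isPrime _
end

section
/- Let k be a perfect field, let n, m ≥ 1, and let f_1, …, f_m ∈ k[X_1,…,X_n]. Let I = (f_1,…,f_m) be the ideal they generate, and suppose the zero locus of I in the prime spectrum of k[X_1,…,X_n] is irreducible. Suppose moreover that there exists a point x ∈ kⁿ with f_i(x) = 0 for all i = 1,…,m such that the m×n Jacobian matrix ((∂f_i/∂X_j)(x))_{i,j} has rank at least m. Then I is a radical ideal, i.e., I equals its own radical. -/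
open MvPolynomial

namespace JacRad
open CategoryTheory CategoryTheory.Abelian RingTheory.Sequence IsLocalRing Module
open scoped Pointwise
universe u

lemma withBot_cancel {a : WithBot ℕ∞} {n d : ℕ}
    (h : a + ((n + 1 : ℕ) : WithBot ℕ∞) ≤ ((d + 1 : ℕ) : WithBot ℕ∞)) :
    a + (n : WithBot ℕ∞) ≤ (d : WithBot ℕ∞) := by
  induction a with
  | bot => simp
  | coe a =>
    induction a with
    | top =>
      exfalso
      have h' : ((⊤ : ℕ∞) + ((n + 1 : ℕ) : ℕ∞)) ≤ ((d + 1 : ℕ) : ℕ∞) := by exact_mod_cast h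
      rw [top_add] at h'
      exact absurd h' (by exact not_le.mpr (ENat.natCast_lt_top _))
    | coe a =>
      norm_cast at h ⊢
      omega

/-- Depth at least `n`, via vanishing of Ext. -/
def DepthGE (R : Type u) [CommRing R] [IsLocalRing R] (M : Type u) [AddCommGroup M] [Module R M]
    (n : ℕ) : Prop :=
  ∀ i < n, Subsingleton (Ext (ModuleCat.of R (R ⧸ maximalIdeal R)) (ModuleCat.of R M) i)

section
variable {R : Type u} [CommRing R] [IsLocalRing R] {M : Type u} [AddCommGroup M] [Module R M]

lemma DepthGE.quot {n : ℕ} (h : DepthGE R M (n + 1)) {f : R} (hf : IsSMulRegular M f) :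
    DepthGE R (QuotSMulTop f M) n := by
  intro i hi
  have zero1 := AddCommGrpCat.isZero_of_iff_subsingleton.mpr (h i (by omega))
  have zero2 := AddCommGrpCat.isZero_of_iff_subsingleton.mpr (h (i + 1) (by omega))
  have hf' : IsSMulRegular (ModuleCat.of R M) f := hf
  exact AddCommGrpCat.subsingleton_of_isZero <| ShortComplex.Exact.isZero_of_both_zeros
    ((Ext.covariant_sequence_exact₃' (ModuleCat.of R (R ⧸ maximalIdeal R))
      hf'.smulShortComplex_shortExact) i (i + 1) rfl)
    (zero1.eq_zero_of_src _) (zero2.eq_zero_of_tgt _)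

lemma DepthGE.exists_reg [IsNoetherianRing R] [Module.Finite R M] {n : ℕ}
    (h : DepthGE R M (n + 1)) : ∃ x ∈ maximalIdeal R, IsSMulRegular M x := by
  have : Subsingleton (ModuleCat.of R (R ⧸ maximalIdeal R) ⟶ ModuleCat.of R M) :=
    Ext.addEquiv₀.subsingleton_congr.mp (h 0 n.zero_lt_succ)
  have : Subsingleton ((R ⧸ maximalIdeal R) →ₗ[R] M) := 
    (ModuleCat.homAddEquiv (M := ModuleCat.of R (R ⧸ maximalIdeal R))
      (N := ModuleCat.of R M)).symm.subsingleton
  obtain ⟨x, mem_ann, hx⟩ := IsSMulRegular.subsingleton_linearMap_iff.mp this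
  rw [Ideal.annihilator_quotient] at mem_ann
  exact ⟨x, mem_ann, hx⟩

lemma DepthGE.of_isWeaklyRegular [IsNoetherianRing R] [Module.Finite R M] [Nontrivial M]
    (rs : List R) (hm : ∀ r ∈ rs, r ∈ maximalIdeal R) (h : IsWeaklyRegular M rs) :
    DepthGE R M rs.length := by
  refine ModuleCat.subsingleton_ext_of_exists_isRegular (maximalIdeal R)
    (ModuleCat.of R (R ⧸ maximalIdeal R)) ?_ (ModuleCat.of R M) ?_ rs hm ?_
  · rw [Module.support_eq_zeroLocus, Ideal.annihilator_quotient]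
  · exact (Submodule.top_ne_ideal_smul_of_le_jacobson_annihilator
      (maximalIdeal_le_jacobson _)).symm.lt_top
  · exact IsRegular.of_isWeaklyRegular_of_mem_maximalIdeal M hm h

lemma DepthGE.le_dim [IsNoetherianRing R] [Module.Finite R M] {d : ℕ}
    (h : DepthGE R M d) (p : Ideal R) (hp : p ∈ associatedPrimes R M) :
    (d : WithBot ℕ∞) ≤ ringKrullDim (R ⧸ p) := by
  induction d generalizing M p with
  | zero =>
    have := hp.1
    simpa using ringKrullDim_nonneg_of_nontrivial
  | succ d ih =>
    obtain ⟨x, hxm, hx⟩ := h.exists_reg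
    have hpp := hp.1
    obtain ⟨-, y, hy⟩ := isAssociatedPrime_iff.mp hp
    have hy0 : y ≠ 0 := by
      rintro rfl
      exact hpp.ne_top (by rw [hy]; simp)
    have hpy : ∀ a ∈ p, a • y = 0 := by
      intro a ha
      rw [hy] at ha
      simpa [Submodule.mem_colon_singleton] using ha
    -- the submodule killed by p
    let N : Submodule R M := ⨅ a : p, LinearMap.ker (LinearMap.lsmul R M a.1)
    have hN : ∀ z, z ∈ N ↔ ∀ a ∈ p, a • z = 0 := by
      intro z; simp [N]
    have hyN : y ∈ N := (hN y).2 hpy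
    -- some element of N is not in xM
    obtain ⟨z, hzN, hz⟩ : ∃ z ∈ N, z ∉ (x • (⊤ : Submodule R M)) := by
      by_contra! hcon
      have hle : N ≤ maximalIdeal R • N := by
        intro z hz
        obtain ⟨w, -, hw⟩ := Submodule.mem_smul_pointwise_iff_exists _ _ _ |>.mp (hcon z hz)
        rw [← hw]
        refine Submodule.smul_mem_smul hxm ((hN w).2 fun a ha => ?_)
        apply hx
        simp only [smul_zero]
        rw [smul_comm, hw]
        exact (hN z).1 hz a ha
      have := Submodule.eq_bot_of_le_smul_of_le_jacobson_bot (maximalIdeal R) N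
        (IsNoetherian.noetherian N) hle (maximalIdeal_le_jacobson _)
      rw [this] at hyN
      exact hy0 (by simpa using hyN)
    have hz0 : (Submodule.Quotient.mk z : QuotSMulTop x M) ≠ 0 := by
      simpa [Submodule.Quotient.mk_eq_zero] using hz
    obtain ⟨q, hq, hle⟩ := exists_le_isAssociatedPrime_of_isNoetherianRing (R := R) _ hz0
    have hqp := hq.1
    have h1 := ih (h.quot hx) q hq
    have hpq : p ≤ q := by
      refine le_trans (fun a ha => ?_) hle
      rw [Submodule.mem_colon_singleton, Submodule.mem_bot, ← Submodule.Quotient.mk_smul,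
        (hN z).1 hzN a ha, Submodule.Quotient.mk_zero]
    have hxq : x ∈ q := by
      apply hle
      rw [Submodule.mem_colon_singleton, Submodule.mem_bot, ← Submodule.Quotient.mk_smul,
        Submodule.Quotient.mk_eq_zero]
      exact Submodule.smul_mem_pointwise_smul _ _ _ trivial
    have hxp : x ∉ p := fun hxp => hy0 (hx (by simpa using hpy x hxp))
    have hr : (Ideal.Quotient.mk p x) ∈ nonZeroDivisors (R ⧸ p) := by
      rw [mem_nonZeroDivisors_iff_ne_zero, Ne, Ideal.Quotient.eq_zero_iff_mem]
      exact hxp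
    have h2 := ringKrullDim_succ_le_of_surjective (Ideal.Quotient.factor hpq)
      (Ideal.Quotient.factor_surjective hpq) hr
      (by simpa [Ideal.Quotient.eq_zero_iff_mem] using hxq)
    push_cast
    exact le_trans (by gcongr) h2

lemma supportDim_le_ofList [IsNoetherianRing R] [Module.Finite R M]
    (fs : List R) (hfs : ∀ r ∈ fs, r ∈ maximalIdeal R) :
    supportDim R M ≤ supportDim R (M ⧸ Ideal.ofList fs • (⊤ : Submodule R M)) + fs.length := by
  induction fs generalizing M with
  | nil =>
    rw [Ideal.ofList_nil, Submodule.bot_smul, supportDim_eq_of_equiv (Submodule.quotEquivOfEqBot _ rfl)]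
    simp
  | cons f fs ih =>
    rw [supportDim_eq_of_equiv (Submodule.quotOfListConsSMulTopEquivQuotSMulTopInner M f fs)]
    have h1 := supportDim_le_supportDim_quotSMulTop_succ (M := M) (hfs f (by simp))
    have h2 := ih (M := QuotSMulTop f M) (fun r hr => hfs r (by simp [hr]))
    refine h1.trans ?_
    rw [List.length_cons, Nat.cast_add, ← add_assoc, Nat.cast_one]
    gcongr

lemma DepthGE.exists_reg_quot [IsNoetherianRing R] [Module.Finite R M] {d : ℕ}
    (h : DepthGE R M d) (fs : List R) (hfs : ∀ r ∈ fs, r ∈ maximalIdeal R)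
    (hdim : supportDim R (M ⧸ Ideal.ofList fs • (⊤ : Submodule R M)) + fs.length ≤ d)
    (hlt : fs.length < d) :
    ∃ x ∈ maximalIdeal R, IsSMulRegular (M ⧸ Ideal.ofList fs • (⊤ : Submodule R M)) x := by
  induction fs generalizing M d with
  | nil =>
    obtain ⟨d, rfl⟩ := Nat.exists_eq_succ_of_ne_zero (by simpa using hlt.ne')
    obtain ⟨x, hxm, hx⟩ := h.exists_reg
    refine ⟨x, hxm, ?_⟩
    have e : (M ⧸ Ideal.ofList ([] : List R) • (⊤ : Submodule R M)) ≃ₗ[R] M :=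
      Submodule.quotEquivOfEqBot _ (by simp)
    exact (e.isSMulRegular_congr x).mpr hx
  | cons f fs ih =>
    obtain ⟨d, rfl⟩ := Nat.exists_eq_succ_of_ne_zero (Nat.ne_zero_of_lt hlt)
    have e := Submodule.quotOfListConsSMulTopEquivQuotSMulTopInner M f fs
    rw [supportDim_eq_of_equiv e] at hdim
    have hfs' : ∀ r ∈ fs, r ∈ maximalIdeal R := fun r hr => hfs r (by simp [hr])
    have hd' : supportDim R (QuotSMulTop f M ⧸ Ideal.ofList fs • (⊤ : Submodule R (QuotSMulTop f M)))
        + fs.length ≤ d := by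
      rw [List.length_cons, Nat.succ_eq_add_one] at hdim
      exact withBot_cancel hdim
    have hs := (supportDim_le_ofList (M := QuotSMulTop f M) fs hfs').trans hd'
    have hreg : IsSMulRegular M f := by
      by_contra hcon
      have hmem : f ∈ ⋃ p ∈ associatedPrimes R M, (p : Set R) := by
        rw [biUnion_associatedPrimes_eq_zero_divisors R M]
        by_contra hc
        refine hcon (IsSMulRegular.of_right_eq_zero_of_smul ?_)
        intro z hz
        by_contra hz0
        exact hc ⟨z, hz0, hz⟩
      simp only [Set.mem_iUnion, SetLike.mem_coe] at hmem
      obtain ⟨p, hp, hfp⟩ := hmem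
      have h1 := h.le_dim p hp
      have hpp := hp.1
      have h2 : ringKrullDim (R ⧸ p) ≤ supportDim R (QuotSMulTop f M) := by
        rw [← supportDim_quotient_eq_ringKrullDim]
        refine Order.krullDim_le_of_strictMono (fun a => ⟨a.1, ?_⟩) (fun {_ _} lt => lt)
        have ha : (a.1 : PrimeSpectrum R) ∈ PrimeSpectrum.zeroLocus (p : Set R) := by
          have h3 : Module.support R (R ⧸ p) = PrimeSpectrum.zeroLocus (p : Set R) := by
            rw [support_eq_zeroLocus, Ideal.annihilator_quotient]
          exact h3.subset a.2
        have hpa : p ≤ a.1.asIdeal := ha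
        have h4 : (a.1 : PrimeSpectrum R) ∈ Module.support R M ∩ PrimeSpectrum.zeroLocus {f} := by
          refine ⟨?_, by simpa using hpa hfp⟩
          rw [Module.mem_support_iff_of_finite, ← Submodule.annihilator_top]
          exact le_trans (IsAssociatedPrime.annihilator_le hp) hpa
        rwa [← Module.support_quotSMulTop] at h4
      have := (h1.trans h2).trans hs
      norm_cast at this
      omega
    obtain ⟨x, hxm, hx⟩ := ih (h.quot hreg) hfs' hd' (by simpa using hlt)
    exact ⟨x, hxm, (e.isSMulRegular_congr x).mpr hx⟩
end
/-- A family in the maximal ideal that is linearly independent in the cotangent space. -/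
def Indep {R : Type u} [CommRing R] [IsLocalRing R] {m : ℕ} (f : Fin m → R) : Prop :=
  (∀ i, f i ∈ maximalIdeal R) ∧
    ∀ c : Fin m → R, ∑ i, c i * f i ∈ maximalIdeal R ^ 2 → ∀ i, c i ∈ maximalIdeal R

section
variable {R : Type u} [CommRing R] [IsLocalRing R]

lemma indep_iff {m : ℕ} (f : Fin m → maximalIdeal R) :
    Indep (fun i => (f i : R)) ↔
      LinearIndependent (ResidueField R) (fun i => (maximalIdeal R).toCotangent (f i)) := by
  have key : ∀ c : Fin m → R, ∑ i, c i * (f i : R) ∈ maximalIdeal R ^ 2 ↔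
      ∑ i, residue R (c i) • ((maximalIdeal R).toCotangent (f i) : CotangentSpace R) = 0 := by
    intro c
    have h1 : ∑ i, residue R (c i) • ((maximalIdeal R).toCotangent (f i) : CotangentSpace R) =
        (maximalIdeal R).toCotangent (∑ i, c i • f i) := by
      rw [map_sum]
      refine Finset.sum_congr rfl fun i _ => ?_
      rw [map_smul]
      exact algebraMap_smul (ResidueField R) (c i) _
    rw [h1, Ideal.toCotangent_eq_zero]
    simp
  rw [Fintype.linearIndependent_iff]
  constructor
  · rintro ⟨-, h⟩ g hg i
    choose c hc using fun i => residue_surjective (R := R) (g i)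
    simp only [← hc] at hg ⊢
    exact (residue_eq_zero_iff _).2 (h c ((key c).2 hg) i)
  · intro h
    refine ⟨fun i => (f i).2, fun c hc i => ?_⟩
    exact (residue_eq_zero_iff _).1 (h (fun i => residue R (c i)) ((key c).1 hc) i)

lemma Indep.quot [IsRegularLocalRing R] {m : ℕ} {f : Fin m → R} (hf : Indep f) :
    IsRegularLocalRing (R ⧸ Ideal.span (Set.range f)) ∧
      ringKrullDim (R ⧸ Ideal.span (Set.range f)) + m = ringKrullDim R := by
  classical
  let F : Fin m → maximalIdeal R := fun i => ⟨f i, hf.1 i⟩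
  have hli := (indep_iff F).1 hf
  set v : Fin m → CotangentSpace R := fun i => (maximalIdeal R).toCotangent (F i) with hv
  set J := Ideal.span (Set.range f) with hJ
  have hJm : J ≤ maximalIdeal R := by
    rw [hJ, Ideal.span_le]; rintro _ ⟨i, rfl⟩; exact hf.1 i
  have hJtop : J ≠ ⊤ := fun h => (maximalIdeal.isMaximal R).ne_top (top_le_iff.1 (h ▸ hJm))
  have : Nontrivial (R ⧸ J) := Ideal.Quotient.nontrivial_iff.2 hJtop
  have : IsLocalRing (R ⧸ J) := .of_surjective' _ Ideal.Quotient.mk_surjective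
  set d := finrank (ResidueField R) (CotangentSpace R) with hd
  have hdim : (d : WithBot ℕ∞) = ringKrullDim R :=
    (IsRegularLocalRing.iff_finrank_cotangentSpace R).1 inferInstance
  -- complete to a basis
  let B := hli.linearIndepOn_id.extend (Set.subset_univ (Set.range v))
  have hB : LinearIndepOn (ResidueField R) id B := hli.linearIndepOn_id.linearIndepOn_extend _
  have hBs : Submodule.span (ResidueField R) B = ⊤ :=
    top_le_iff.1 (fun x hx => by simpa using hli.linearIndepOn_id.subset_span_extend (Set.subset_univ _) (Set.mem_univ x))
  have hvB : Set.range v ⊆ B := hli.linearIndepOn_id.subset_extend _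
  have hBfin : B.Finite := hB.linearIndependent.setFinite
  have hBcard : B.ncard = d := by
    have := hBfin.fintype
    rw [hd, ← Nat.card_coe_set_eq, Nat.card_eq_fintype_card]
    have hb := finrank_span_eq_card (R := ResidueField R) (b := ((↑) : B → CotangentSpace R)) hB.linearIndependent
    rw [← hb, Subtype.range_coe, hBs, finrank_top]
  let t := B \ Set.range v
  have htcard : t.ncard + m = d := by
    have h1 := Set.ncard_sdiff_add_ncard_of_subset hvB hBfin
    rw [hBcard] at h1
    have h2 : (Set.range v).ncard = m := by
      rw [← Nat.card_coe_set_eq, Nat.card_range_of_injective hli.injective]; simp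
    rw [h2] at h1
    exact h1
  have htfin : t.Finite := hBfin.sdiff
  let g := Function.surjInv (maximalIdeal R).toCotangent_surjective
  have hg : ∀ c, (maximalIdeal R).toCotangent (g c) = c := Function.surjInv_eq _
  have hspan : Submodule.span R (Set.range F ∪ g '' t) = ⊤ := by
    rw [← CotangentSpace.span_image_eq_top_iff, Set.image_union, ← Set.range_comp, Set.image_image]
    simp only [hg, Set.image_id']
    have : (⇑(maximalIdeal R).toCotangent ∘ F) = v := rfl
    rw [this, Set.union_sdiff_cancel hvB, hBs]
  let T : Set R := Subtype.val '' (g '' t)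
  have hmax : maximalIdeal R = J ⊔ Ideal.span T := by
    have h1 := congrArg (Submodule.map (maximalIdeal R).subtype) hspan
    rw [Submodule.map_span, Submodule.map_top, Submodule.range_subtype, Set.image_union,
      ← Set.range_comp, Submodule.span_union] at h1
    exact h1.symm
  have hmax' : maximalIdeal (R ⧸ J) = Ideal.span (Ideal.Quotient.mk J '' T) := by
    have h2 : (maximalIdeal R).map (Ideal.Quotient.mk J) = maximalIdeal (R ⧸ J) := by
      refine IsLocalRing.eq_maximalIdeal ?_
      have := Ideal.map_eq_top_or_isMaximal_of_surjective (Ideal.Quotient.mk J)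
        Ideal.Quotient.mk_surjective (maximalIdeal.isMaximal R)
      refine this.resolve_left fun h => ?_
      have h3 := congrArg (Ideal.comap (Ideal.Quotient.mk J)) h
      rw [Ideal.comap_map_of_surjective _ Ideal.Quotient.mk_surjective, Ideal.comap_top,
        ← RingHom.ker_eq_comap_bot, Ideal.mk_ker, sup_eq_left.2 hJm] at h3
      exact (maximalIdeal.isMaximal R).ne_top h3
    rw [← h2, hmax, Ideal.map_sup, Ideal.map_quotient_self, bot_sup_eq, Ideal.map_span]
  have hTfin : (Ideal.Quotient.mk J '' T).Finite := ((htfin.image _).image _).image _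
  have hTcard : (Ideal.Quotient.mk J '' T).ncard ≤ t.ncard :=
    (Set.ncard_image_le ((htfin.image _).image _)).trans
      ((Set.ncard_image_le (htfin.image _)).trans (Set.ncard_image_le htfin))
  have hsf : (maximalIdeal (R ⧸ J)).spanFinrank ≤ t.ncard := by
    rw [hmax']
    exact (Submodule.spanFinrank_span_le_ncard_of_finite hTfin).trans hTcard
  have hup := ringKrullDim_le_spanFinrank_maximalIdeal (R ⧸ J)
  have hlow : ringKrullDim R ≤ ringKrullDim (R ⧸ J) + m := by
    have h1 := ringKrullDim_le_ringKrullDim_quotient_add_encard (Set.range f) (by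
      rw [IsLocalRing.ringJacobson_eq_maximalIdeal]; rintro _ ⟨i, rfl⟩; exact hf.1 i)
    refine h1.trans ?_
    gcongr
    have : (Set.range f).encard ≤ m := by
      rw [← Set.image_univ]
      refine (Set.encard_image_le _ _).trans ?_
      simp
    exact_mod_cast this
  obtain ⟨e, he⟩ : ∃ e : ℕ, ringKrullDim (R ⧸ J) = e := by
    obtain ⟨e, he⟩ := WithBot.ne_bot_iff_exists.1 (ringKrullDim_ne_bot (R := R ⧸ J))
    rw [← he] at hup
    have : e ≠ ⊤ := by
      rintro rfl
      have h' : (⊤ : ℕ∞) ≤ ((maximalIdeal (R ⧸ J)).spanFinrank : ℕ∞) := by exact_mod_cast hup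
      exact absurd h' (not_le.mpr (ENat.natCast_lt_top _))
    obtain ⟨e', rfl⟩ := ENat.ne_top_iff_exists.1 this
    exact ⟨e', he.symm⟩
  rw [he, ← hdim] at hlow
  rw [he] at hup
  norm_cast at hlow hup
  constructor
  · apply IsRegularLocalRing.of_spanFinrank_maximalIdeal_le
    rw [he]; norm_cast; omega
  · rw [he, ← hdim]; norm_cast; omega

lemma exists_indep [IsRegularLocalRing R] {d : ℕ} (hd : ringKrullDim R = d) :
    ∃ f : Fin d → R, Indep f := by
  have hdim := (IsRegularLocalRing.iff_finrank_cotangentSpace R).1 inferInstance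
  rw [hd] at hdim
  have hdim' : finrank (ResidueField R) (CotangentSpace R) = d := by exact_mod_cast hdim
  let b := finBasisOfFinrankEq _ _ hdim'
  choose g hg using fun i => (maximalIdeal R).toCotangent_surjective (b i)
  refine ⟨fun i => (g i : R), (indep_iff g).2 ?_⟩
  simp only [hg]
  exact b.linearIndependent

lemma indep_singleton {x : R} (hx : x ∈ maximalIdeal R) (hx2 : x ∉ maximalIdeal R ^ 2) :
    Indep (fun _ : Fin 1 => x) := by
  refine ⟨fun _ => hx, fun c hc i => ?_⟩
  simp only [Finset.univ_unique, Finset.sum_singleton] at hc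
  rw [Subsingleton.elim i default]
  by_contra hcon
  rw [mem_maximalIdeal, mem_nonunits_iff, not_not] at hcon
  exact hx2 ((Ideal.unit_mul_mem_iff_mem _ hcon).1 hc)

end

lemma isDomain_aux (d : ℕ) : ∀ (R : Type u) [CommRing R] [IsRegularLocalRing R],
    ringKrullDim R = d → IsDomain R := by
  induction d with
  | zero =>
    intro R _ _ hd
    have h := (IsRegularLocalRing.iff_finrank_cotangentSpace R).1 inferInstance
    rw [hd] at h
    have h' : finrank (ResidueField R) (CotangentSpace R) = 0 := by exact_mod_cast h
    exact (finrank_cotangentSpace_eq_zero_iff.1 h').isDomain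
  | succ d ih =>
    intro R _ _ hd
    have hnf : ¬ IsField R := by
      intro h
      have := ringKrullDim_eq_zero_of_isField h
      rw [this] at hd
      norm_cast at hd
    have hfin : (minimalPrimes R).Finite := minimalPrimes.finite_of_isNoetherianRing R
    obtain ⟨x, hxm, hx2, hxp⟩ : ∃ x ∈ maximalIdeal R, x ∉ maximalIdeal R ^ 2 ∧
        ∀ p ∈ minimalPrimes R, x ∉ p := by
      by_contra! hcon
      have hsub : ((maximalIdeal R : Ideal R) : Set R) ⊆
          ⋃ I ∈ (insert (maximalIdeal R ^ 2) (minimalPrimes R)), ((I : Ideal R) : Set R) := by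
        intro x hx
        by_cases h2 : x ∈ maximalIdeal R ^ 2
        · exact Set.mem_biUnion (Set.mem_insert _ _) h2
        · obtain ⟨p, hp, hxp⟩ := hcon x hx h2
          exact Set.mem_biUnion (Set.mem_insert_of_mem _ hp) hxp
      have := (Ideal.subset_union_prime_finite (f := fun I : Ideal R => I)
        (hfin.insert (maximalIdeal R ^ 2)) (maximalIdeal R ^ 2) (maximalIdeal R ^ 2) (by
          intro I hI h1 _
          exact (Set.mem_of_mem_insert_of_ne hI h1).1.1)).1 hsub
      obtain ⟨I, hI, hle⟩ := this
      rcases Set.mem_insert_iff.1 hI with rfl | hI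
      · have h0 := Submodule.eq_bot_of_le_smul_of_le_jacobson_bot (maximalIdeal R) (maximalIdeal R)
          (IsNoetherian.noetherian _) (by rw [smul_eq_mul, ← pow_two]; exact hle)
          (maximalIdeal_le_jacobson _)
        exact hnf (isField_iff_maximalIdeal_eq.2 h0)
      · have hpI := hI.1.1
        have heq : I = maximalIdeal R := le_antisymm (le_maximalIdeal hpI.ne_top) hle
        have hh := Ideal.height_eq_zero_iff.2 hI
        rw [heq] at hh
        have := IsLocalRing.maximalIdeal_height_eq_ringKrullDim (R := R)
        rw [hh, hd] at this
        norm_cast at this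
    obtain ⟨hreg, hdim⟩ := (indep_singleton hxm hx2).quot
    rw [Set.range_const] at hreg hdim
    have hdim' : ringKrullDim (R ⧸ Ideal.span {x}) = d := by
      rw [hd] at hdim
      refine le_antisymm ?_ ?_
      · simpa using withBot_cancel (n := 0) (by simpa using hdim.le)
      · obtain ⟨e, he⟩ := WithBot.ne_bot_iff_exists.1 (ringKrullDim_ne_bot (R := R ⧸ Ideal.span {x}))
        rw [← he] at hdim ⊢
        induction e with
        | top => exact_mod_cast le_top
        | coe e =>
        norm_cast at hdim ⊢
        omega
    have hdom := ih (R ⧸ Ideal.span {x}) hdim'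
    have hprime : (Ideal.span {x}).IsPrime := (Ideal.Quotient.isDomain_iff_prime _).1 hdom
    obtain ⟨p, hp, hle⟩ := Ideal.exists_minimalPrimes_le (I := (⊥ : Ideal R)) (J := Ideal.span {x}) bot_le
    have hpp := hp.1.1
    have hp0 : p = ⊥ := by
      refine Submodule.eq_bot_of_le_smul_of_le_jacobson_bot (maximalIdeal R) p
          (IsNoetherian.noetherian _) ?_ (maximalIdeal_le_jacobson _)
      intro y hy
      obtain ⟨z, rfl⟩ := Ideal.mem_span_singleton'.1 (hle hy)
      have hz := (hpp.mem_or_mem hy).resolve_right (hxp p hp)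
      rw [mul_comm]
      exact Submodule.smul_mem_smul hxm hz
    rw [hp0] at hpp
    exact (IsDomain.of_bot_isPrime R)

lemma exists_dim (R : Type u) [CommRing R] [IsRegularLocalRing R] :
    ∃ d : ℕ, ringKrullDim R = d :=
  ⟨_, ((IsRegularLocalRing.iff_finrank_cotangentSpace R).1 inferInstance).symm⟩

lemma isDomain_of_regular (R : Type u) [CommRing R] [IsRegularLocalRing R] : IsDomain R := by
  obtain ⟨d, hd⟩ := exists_dim R
  exact isDomain_aux d R hd

section
variable {R : Type u} [CommRing R] [IsRegularLocalRing R]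

lemma Indep.isPrime {m : ℕ} {f : Fin m → R} (hf : Indep f) :
    (Ideal.span (Set.range f)).IsPrime := by
  have := hf.quot.1
  exact (Ideal.Quotient.isDomain_iff_prime _).1 (isDomain_of_regular _)

lemma Indep.castLE {m n : ℕ} (h : n ≤ m) {f : Fin m → R} (hf : Indep f) :
    Indep (fun i : Fin n => f (Fin.castLE h i)) := by
  classical
  refine ⟨fun i => hf.1 _, fun c hc i => ?_⟩
  let c' : Fin m → R := fun j => if hj : j.1 < n then c ⟨j.1, hj⟩ else 0
  have h1 : ∀ i, c' (Fin.castLE h i) = c i := fun i => by simp [c']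
  have h2 : ∑ j, c' j * f j = ∑ i, c i * f (Fin.castLE h i) := by
    symm
    refine Fintype.sum_of_injective (Fin.castLE h) (Fin.castLE_injective h) _ _ ?_ ?_
    · intro j hj
      have : ¬ j.1 < n := fun hlt => hj ⟨⟨j.1, hlt⟩, rfl⟩
      simp [c', this]
    · intro i; rw [h1]
  rw [← h1]
  exact hf.2 c' (h2 ▸ hc) _

lemma Indep.notMem {m n : ℕ} (h : n < m) {f : Fin m → R} (hf : Indep f) :
    f ⟨n, h⟩ ∉ Ideal.span (Set.range (fun i : Fin n => f (Fin.castLE h.le i))) := by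
  intro hmem
  have hf' := hf.castLE (n := n + 1) h
  obtain ⟨c, hc⟩ := (Ideal.mem_span_range_iff_exists_fun).1 hmem
  have := hf'.2 (Fin.snoc (fun i => - c i) 1) (by
    rw [Fin.sum_univ_castSucc]
    simp only [Fin.snoc_castSucc, Fin.snoc_last, one_mul, neg_mul, Finset.sum_neg_distrib]
    have h3 : f (Fin.castLE h (Fin.last n)) = f ⟨n, h⟩ := rfl
    rw [h3, ← hc]
    have h4 : ∀ i : Fin n, Fin.castLE h i.castSucc = Fin.castLE h.le i := fun i => rfl
    simp [h4]) (Fin.last n)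
  rw [Fin.snoc_last] at this
  exact (maximalIdeal.isMaximal R).ne_top ((Ideal.eq_top_iff_one _).2 this)

lemma Indep.le_height {m : ℕ} {f : Fin m → R} (hf : Indep f) :
    (m : ℕ∞) ≤ (Ideal.span (Set.range f)).height := by
  induction m with
  | zero => simp
  | succ m ih =>
    have hf' := hf.castLE (n := m) (Nat.le_succ m)
    have h1 := ih hf'
    have := hf'.isPrime
    have := hf.isPrime
    have hlt : Ideal.span (Set.range (fun i : Fin m => f (Fin.castLE (Nat.le_succ m) i))) <
        Ideal.span (Set.range f) := by
      refine lt_of_le_of_ne (Ideal.span_mono ?_) ?_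
      · rintro _ ⟨i, rfl⟩; exact ⟨_, rfl⟩
      · intro h
        apply hf.notMem (Nat.lt_succ_self m)
        rw [h]
        exact Ideal.subset_span ⟨_, rfl⟩
    have h2 := Ideal.height_add_one_le_of_lt_of_isPrime hlt
    push_cast
    exact le_trans (by gcongr) h2

lemma depthGE_of_regular {d : ℕ} (hd : ringKrullDim R = d) : DepthGE R R d := by
  obtain ⟨f, hf⟩ := exists_indep hd
  have h := DepthGE.of_isWeaklyRegular (M := R) (List.ofFn f) (by
    intro r hr
    obtain ⟨i, rfl⟩ := (List.mem_ofFn' _ _).1 hr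
    exact hf.1 i) (by
    refine (isWeaklyRegular_iff _ _).2 fun i hi => ?_
    have hi' : i < d := by simpa using hi
    have hfi := hf.castLE hi'.le
    have hJ : Ideal.ofList ((List.ofFn f).take i) • (⊤ : Submodule R R) =
        Ideal.span (Set.range (fun j : Fin i => f (Fin.castLE hi'.le j))) := by
      rw [smul_eq_mul, Ideal.mul_top, Ideal.ofList]
      congr 1
      ext r
      simp only [Set.mem_ofPred_eq, Set.mem_range, List.mem_take_iff_getElem, List.getElem_ofFn]
      constructor
      · rintro ⟨j, hj, rfl⟩
        exact ⟨⟨j, by omega⟩, rfl⟩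
      · rintro ⟨j, rfl⟩
        exact ⟨j, by simp; omega, rfl⟩
    rw [hJ]
    have hpr := hfi.isPrime
    refine IsSMulRegular.of_right_eq_zero_of_smul ?_
    intro z hz
    obtain ⟨z, rfl⟩ := Ideal.Quotient.mk_surjective z
    have hz' : (List.ofFn f)[i] * z ∈ Ideal.span (Set.range (fun j : Fin i => f (Fin.castLE hi'.le j))) := by
      rw [← Ideal.Quotient.eq_zero_iff_mem]
      exact hz
    rw [Ideal.Quotient.eq_zero_iff_mem]
    refine (hpr.mem_or_mem hz').resolve_left ?_
    rw [List.getElem_ofFn]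
    exact hf.notMem hi')
  simpa using h
end
end JacRad
namespace JacRad
open RingTheory.Sequence IsLocalRing Module
universe u
open scoped Pointwise

lemma dim_quot_add_height_le {R : Type u} [CommRing R] (P J : Ideal R) [hP : P.IsPrime]
    (hPJ : P ≤ J.radical) {m : ℕ} (hm : (m : ℕ∞) ≤ P.height) :
    ringKrullDim (R ⧸ J) + m ≤ ringKrullDim R := by
  have h1 : ringKrullDim (R ⧸ J) ≤ ringKrullDim (R ⧸ P) := by
    rw [ringKrullDim_quotient, ringKrullDim_quotient]
    refine Order.krullDim_le_of_strictMono (fun a => ⟨a.1, ?_⟩) (fun {_ _} lt => lt)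
    have ha : J ≤ a.1.asIdeal := a.2
    exact hPJ.trans (a.1.isPrime.isRadical.radical_le_iff.2 ha)
  let p : PrimeSpectrum R := ⟨P, hP⟩
  have h2 : ringKrullDim (R ⧸ P) = (Order.coheight p : WithBot ℕ∞) := by
    rw [ringKrullDim_quotient, Order.coheight_eq_krullDim_Ici]
    rfl
  have : Nonempty (PrimeSpectrum R) := ⟨p⟩
  have h3 : ((Order.height p + Order.coheight p : ℕ∞) : WithBot ℕ∞) ≤ ringKrullDim R := by
    rw [ringKrullDim, Order.krullDim_eq_iSup_height_add_coheight_of_nonempty]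
    exact WithBot.coe_le_coe.2 (le_iSup (fun a : PrimeSpectrum R => Order.height a + Order.coheight a) p)
  have h4 : (m : ℕ∞) ≤ Order.height p := by
    rw [← PrimeSpectrum.height_eq_orderHeight]; exact hm
  calc ringKrullDim (R ⧸ J) + m ≤ (Order.coheight p : WithBot ℕ∞) + m := by rw [← h2]; gcongr
    _ = ((Order.coheight p + m : ℕ∞) : WithBot ℕ∞) := by push_cast; rfl
    _ ≤ ((Order.height p + Order.coheight p : ℕ∞) : WithBot ℕ∞) := by
        rw [add_comm (Order.height p)]
        exact WithBot.coe_le_coe.2 (by gcongr)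
    _ ≤ _ := h3

lemma assoc_eq {A : Type u} [CommRing A] [IsRegularRing A] {m : ℕ} (f : Fin m → A)
    (I : Ideal A) (hI : I = Ideal.span (Set.range f)) (hP : I.radical.IsPrime)
    (hm : (m : ℕ∞) ≤ I.radical.height) (Q : Ideal A) (hQ : IsAssociatedPrime Q (A ⧸ I)) :
    Q ≤ I.radical := by
  by_contra hcon
  have hQp := hQ.1
  obtain ⟨-, w, hw⟩ := isAssociatedPrime_iff.1 hQ
  obtain ⟨w, rfl⟩ := Ideal.Quotient.mk_surjective w
  have hQw : ∀ a, a ∈ Q ↔ a * w ∈ I := by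
    intro a
    rw [hw, Submodule.mem_colon_singleton, Submodule.mem_bot, ← Ideal.Quotient.eq_zero_iff_mem]
    rfl
  have hIQ : I ≤ Q := fun a ha => (hQw a).2 (I.mul_mem_right _ ha)
  have hPQ : I.radical ≤ Q := hQp.isRadical.radical_le_iff.2 hIQ
  have hlt : I.radical < Q := lt_of_le_not_ge hPQ hcon
  let R := Localization.AtPrime Q
  have : IsRegularLocalRing R := IsRegularRing.isRegularLocalRing_localization Q
  obtain ⟨d, hd⟩ := exists_dim R
  have hht : ringKrullDim R = Q.height := IsLocalization.AtPrime.ringKrullDim_eq_height Q R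
  have hmd : m < d := by
    have h1 := Ideal.height_add_one_le_of_lt_of_isPrime hlt
    have h2 : Q.height = (d : ℕ∞) := by
      rw [hd] at hht; exact_mod_cast hht.symm
    rw [h2] at h1
    have h3 : (m : ℕ∞) + 1 ≤ d := le_trans (by gcongr) h1
    exact_mod_cast h3
  let fs : List R := List.ofFn (fun i => algebraMap A R (f i))
  have hfsI : Ideal.ofList fs = I.map (algebraMap A R) := by
    rw [hI, Ideal.map_span, Ideal.ofList, ← Set.range_comp]
    congr 1
    ext r
    simp [fs, List.mem_ofFn', Set.mem_range]
  have hsm : Ideal.ofList fs • (⊤ : Submodule R R) = I.map (algebraMap A R) := by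
    rw [smul_eq_mul, Ideal.mul_top, hfsI]
  have hdisj : Disjoint (Q.primeCompl : Set A) (I.radical : Set A) := by
    rw [Set.disjoint_left]
    intro a ha ha'
    exact ha (hPQ ha')
  have hPR : (I.radical.map (algebraMap A R)).IsPrime :=
    IsLocalization.isPrime_of_isPrime_disjoint Q.primeCompl R _ hP hdisj
  have hdim : ringKrullDim (R ⧸ I.map (algebraMap A R)) + m ≤ ringKrullDim R := by
    refine dim_quot_add_height_le (I.radical.map (algebraMap A R)) _ ?_ ?_
    · exact Ideal.map_radical_le _
    · rw [IsLocalization.height_map_of_disjoint Q.primeCompl I.radical hdisj]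
      exact hm
  have hlen : fs.length = m := by simp [fs]
  have hmax : ∀ a : A, algebraMap A R a ∈ maximalIdeal R ↔ a ∈ Q :=
    fun a => IsLocalization.AtPrime.to_map_mem_maximal_iff R Q a
  obtain ⟨x, hxm, hx⟩ := (depthGE_of_regular hd).exists_reg_quot fs (by
    intro r hr
    obtain ⟨i, rfl⟩ := (List.mem_ofFn' _ _).1 hr
    rw [hmax]
    exact hIQ (hI ▸ Ideal.subset_span ⟨i, rfl⟩)) (by
    rw [hlen, hsm, supportDim_quotient_eq_ringKrullDim, ← hd]
    exact hdim) (by omega)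
  rw [hsm] at hx
  -- `x` kills the class of `w`
  have hkill : x * algebraMap A R w ∈ I.map (algebraMap A R) := by
    have hle : maximalIdeal R ≤ (I.map (algebraMap A R)).colon {algebraMap A R w} := by
      rw [← Localization.AtPrime.map_eq_maximalIdeal, Ideal.map_le_iff_le_comap]
      intro a ha
      rw [Ideal.mem_comap, Submodule.mem_colon_singleton, smul_eq_mul, ← map_mul]
      exact Ideal.mem_map_of_mem _ ((hQw a).1 ha)
    simpa [Submodule.mem_colon_singleton] using hle hxm
  have hw0 : (Ideal.Quotient.mk (I.map (algebraMap A R)) (algebraMap A R w)) = 0 := by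
    apply hx
    simp only [smul_zero]
    rw [← Ideal.Quotient.eq_zero_iff_mem] at hkill
    exact hkill
  rw [Ideal.Quotient.eq_zero_iff_mem, IsLocalization.algebraMap_mem_map_algebraMap_iff Q.primeCompl]
    at hw0
  obtain ⟨s, hs, hsw⟩ := hw0
  exact hs ((hQw s).2 hsw)

lemma radical_of_indep {A : Type u} [CommRing A] [IsRegularRing A] {m : ℕ} (f : Fin m → A)
    (I : Ideal A) (hI : I = Ideal.span (Set.range f)) (hP : I.radical.IsPrime)
    (M : Ideal A) [hM : M.IsPrime] (hIM : I ≤ M)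
    (hind : Indep (R := Localization.AtPrime M) (fun i => algebraMap A _ (f i))) :
    I.IsRadical := by
  let R := Localization.AtPrime M
  have : IsRegularLocalRing R := IsRegularRing.isRegularLocalRing_localization M
  have hmap : I.map (algebraMap A R) = Ideal.span (Set.range fun i => algebraMap A R (f i)) := by
    rw [hI, Ideal.map_span, ← Set.range_comp]; rfl
  have hPM : I.radical ≤ M := hM.isRadical.radical_le_iff.2 hIM
  have hdisj : Disjoint (M.primeCompl : Set A) (I.radical : Set A) := by
    rw [Set.disjoint_left]
    intro a ha ha'
    exact ha (hPM ha')
  have hprime := hind.isPrime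
  have hht := hind.le_height
  rw [← hmap] at hprime hht
  have hloc : I.radical.map (algebraMap A R) ≤ I.map (algebraMap A R) :=
    (Ideal.map_radical_le _).trans hprime.isRadical
  have hm : (m : ℕ∞) ≤ I.radical.height := by
    rw [← IsLocalization.height_map_of_disjoint (S := R) M.primeCompl I.radical hdisj]
    exact hht.trans (Ideal.height_mono (Ideal.map_mono Ideal.le_radical))
  intro u hu
  by_contra huI
  have hu0 : (Ideal.Quotient.mk I u) ≠ 0 := by rwa [Ne, Ideal.Quotient.eq_zero_iff_mem]
  obtain ⟨Q, hQ, hle⟩ := exists_le_isAssociatedPrime_of_isNoetherianRing (R := A) _ hu0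
  have hQP := assoc_eq f I hI hP hm Q hQ
  have h1 : algebraMap A R u ∈ I.map (algebraMap A R) := hloc (Ideal.mem_map_of_mem _ hu)
  rw [IsLocalization.algebraMap_mem_map_algebraMap_iff M.primeCompl] at h1
  obtain ⟨s, hs, hsu⟩ := h1
  refine hs (hPM (hQP (hle ?_)))
  rw [Submodule.mem_colon_singleton, Submodule.mem_bot]
  exact Ideal.Quotient.eq_zero_iff_mem.2 hsu

lemma indep_of_jacobian {k : Type u} [Field k] {n m : ℕ}
    (f : Fin m → MvPolynomial (Fin n) k)
    (x : Fin n → k) (hx : ∀ i, MvPolynomial.eval x (f i) = 0)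
    (hrank : m ≤ (Matrix.of fun i j => MvPolynomial.eval x (MvPolynomial.pderiv j (f i)) :
      Matrix (Fin m) (Fin n) k).rank)
    (M : Ideal (MvPolynomial (Fin n) k)) [M.IsPrime]
    (hM : M = RingHom.ker (MvPolynomial.eval x)) :
    Indep (R := Localization.AtPrime M) (fun i => algebraMap _ _ (f i)) := by
  let A := MvPolynomial (Fin n) k
  let R := Localization.AtPrime M
  have hmax : ∀ a : A, algebraMap A R a ∈ maximalIdeal R ↔ a ∈ M :=
    fun a => IsLocalization.AtPrime.to_map_mem_maximal_iff R M a
  have hmem : ∀ a : A, a ∈ M ↔ MvPolynomial.eval x a = 0 := fun a => by rw [hM, RingHom.mem_ker]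
  -- rows are independent
  have hli : LinearIndependent k (Matrix.of fun i j => MvPolynomial.eval x
      (MvPolynomial.pderiv j (f i)) : Matrix (Fin m) (Fin n) k).row := by
    rw [linearIndependent_iff_card_le_finrank_span, Fintype.card_fin]
    rw [Matrix.rank_eq_finrank_span_row] at hrank
    exact hrank
  rw [Fintype.linearIndependent_iff] at hli
  -- derivatives of elements of `M ^ 2` vanish at `x`
  have hder : ∀ a ∈ M ^ 2, ∀ j, MvPolynomial.eval x (MvPolynomial.pderiv j a) = 0 := by
    intro a ha j
    rw [pow_two] at ha
    induction ha using Submodule.mul_induction_on' with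
    | mem_mul_mem a ha b hb =>
      rw [Derivation.leibniz]
      simp [(hmem a).1 ha, (hmem b).1 hb]
    | add a _ b _ h1 h2 => simp [h1, h2]
  refine ⟨fun i => (hmax _).2 ((hmem _).2 (hx i)), fun c hc i => ?_⟩
  obtain ⟨s, hs⟩ := IsLocalization.exist_integer_multiples_of_finite M.primeCompl c
  choose a ha using hs
  have h1 : algebraMap A R (∑ i, a i * f i) ∈ (M ^ 2).map (algebraMap A R) := by
    have h2 : algebraMap A R (∑ i, a i * f i) =
        algebraMap A R s * ∑ i, c i * algebraMap A R (f i) := by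
      rw [map_sum, Finset.mul_sum]
      refine Finset.sum_congr rfl fun i _ => ?_
      rw [map_mul, ha i, Algebra.smul_def, mul_assoc]
    rw [h2, Ideal.map_pow, Localization.AtPrime.map_eq_maximalIdeal]
    exact Ideal.mul_mem_left _ _ hc
  rw [IsLocalization.algebraMap_mem_map_algebraMap_iff M.primeCompl] at h1
  obtain ⟨t, ht, hta⟩ := h1
  have ht0 : MvPolynomial.eval x t ≠ 0 := fun h => ht ((hmem t).2 h)
  have h3 := hli (fun i => MvPolynomial.eval x (a i)) (by
    ext j
    have h4 := hder _ hta j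
    rw [Derivation.leibniz] at h4
    simp only [map_sum, Derivation.leibniz, smul_eq_mul, map_add, map_mul, hx, mul_zero, zero_mul,
      Finset.sum_const_zero, add_zero, Finset.mul_sum] at h4
    rw [← Finset.mul_sum] at h4
    have h5 := (mul_eq_zero.1 h4).resolve_left ht0
    simpa [Matrix.row, Finset.sum_apply] using h5) i
  have h6 : algebraMap A R (a i) ∈ maximalIdeal R := (hmax _).2 ((hmem _).2 h3)
  rw [ha i, Algebra.smul_def] at h6
  refine ((maximalIdeal.isMaximal R).isPrime.mem_or_mem h6).resolve_left fun h => ?_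
  exact s.2 ((hmax _).1 h)

end JacRad

/-- Let `k` be a perfect field and `I = (f₁, …, f_m)` an ideal of `k[X₁, …, X_n]` whose zero
locus in `Spec k[X₁, …, X_n]` is irreducible. If the Jacobian matrix of `f₁, …, f_m` has rank
at least `m` at some common zero `x ∈ kⁿ` of the `fᵢ`, then `I` is a radical ideal. -/
theorem jacobian_criterion_radical {k : Type*} [Field k] [PerfectField k]
    {n m : ℕ} (hn : 1 ≤ n) (hm : 1 ≤ m)
    (f : Fin m → MvPolynomial (Fin n) k)
    (I : Ideal (MvPolynomial (Fin n) k)) (hI : I = Ideal.span (Set.range f))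
    (hirr : IsIrreducible (PrimeSpectrum.zeroLocus (I : Set (MvPolynomial (Fin n) k))))
    (x : Fin n → k) (hx : ∀ i, MvPolynomial.eval x (f i) = 0)
    (hrank : m ≤ (Matrix.of fun i j => MvPolynomial.eval x (MvPolynomial.pderiv j (f i)) :
      Matrix (Fin m) (Fin n) k).rank) :
    I.IsRadical := by
  have hxI : I ≤ RingHom.ker (MvPolynomial.eval x) := by
    rw [hI, Ideal.span_le]
    rintro _ ⟨i, rfl⟩
    exact hx i
  have hP : I.radical.IsPrime := (PrimeSpectrum.isIrreducible_zeroLocus_iff I).1 hirr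
  have hker : (RingHom.ker (MvPolynomial.eval x)).IsPrime := RingHom.ker_isPrime _
  exact JacRad.radical_of_indep f I hI hP (RingHom.ker (MvPolynomial.eval x)) hxI
    (JacRad.indep_of_jacobian f x hx hrank _ rfl)
end
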